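/- arXiv:1708.01849 — 8 statements merged into one kernel-verified Lean document; each statement's English description precedes it below -/
import Mathlib

section
/- For every positive integer t and every integer k ≥ 2 with k not divisible by 3, there exists a near-modular set modulo 3^t whose maximum element is k·3^{t−1}. -/
/-- `z` is mod-covered by `A` modulo `N`. -/
def ModCovered (N : ℕ) (A : Set ℕ) (z : ℤ) : Prop :=
  ∃ x ∈ A, ∃ y ∈ A, x ≤ y ∧ 2 * (y : ℤ) - (x : ℤ) ≡ z [ZMOD (N : ℤ)]

/-- `A` is 3-free modulo `N`: any mod-AP in `A` is trivial. -/
def ThreeFreeMod (N : ℕ) (A : Set ℕ) : Prop :=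
  ∀ x ∈ A, ∀ y ∈ A, ∀ z ∈ A,
    ((x : ℤ) + (z : ℤ) ≡ 2 * (y : ℤ) [ZMOD (N : ℤ)]) → x = y ∧ y = z

/-- `A` is a near-modular set modulo `N`. -/
def NearModular (N : ℕ) (A : Finset ℕ) : Prop :=
  0 ∈ A ∧ ThreeFreeMod N ↑A ∧ ∀ z : ℤ, ModCovered N ↑A z

/-- `A` is a modular set modulo `N`: near-modular and contained in `{0, …, N-1}`. -/
def ModularSet (N : ℕ) (A : Finset ℕ) : Prop :=
  NearModular N A ∧ ∀ a ∈ A, a < N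

/-- `S` is 3-free and mod-covers every integer modulo `N`. -/
def ThreeFreeCovering (N : ℕ) (S : Finset ℕ) : Prop :=
  ThreeFreeMod N ↑S ∧ ∀ z : ℤ, ModCovered N ↑S z

/-- The set `3A ∪ (3S + 1)`. -/
def tripleUnion (A S : Finset ℕ) : Finset ℕ :=
  A.image (fun a => 3 * a) ∪ S.image (fun s => 3 * s + 1)

/-- The set `(3S + 3) ∪ (3S + 1)`. -/
def tripleShift (S : Finset ℕ) : Finset ℕ :=
  S.image (fun s => 3 * s + 3) ∪ S.image (fun s => 3 * s + 1)

/-- Every integer is covered modulo `N` by a pair from `A` and `S`, so that `tripleUnion A S`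
mod-covers the integers congruent to `2` modulo `3`. -/
def CrossCovering (N : ℕ) (A S : Finset ℕ) : Prop :=
  ∀ z : ℤ, (∃ a ∈ A, ∃ s ∈ S, a ≤ s ∧ 2 * (s : ℤ) - a ≡ z [ZMOD N]) ∨
    ∃ a ∈ A, ∃ s ∈ S, s < a ∧ 2 * (a : ℤ) - s - 1 ≡ z [ZMOD N]

lemma mem_tripleUnion {A S : Finset ℕ} {x : ℕ} :
    x ∈ tripleUnion A S ↔ (∃ a ∈ A, 3 * a = x) ∨ ∃ s ∈ S, 3 * s + 1 = x := by
  simp [tripleUnion]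

lemma mem_tripleShift {S : Finset ℕ} {x : ℕ} :
    x ∈ tripleShift S ↔ (∃ s ∈ S, 3 * s + 3 = x) ∨ ∃ s ∈ S, 3 * s + 1 = x := by
  simp [tripleShift]

lemma modEq_three_mul {N : ℕ} {a b x y : ℤ} (h : a ≡ b [ZMOD N])
    (hxy : y - x = 3 * (b - a)) : x ≡ y [ZMOD ((3 * N : ℕ) : ℤ)] := by
  rw [Int.modEq_iff_dvd] at h ⊢
  rw [hxy, Nat.cast_mul]
  exact mul_dvd_mul_left _ h

lemma modEq_of_three_mul {N : ℕ} {a b x y : ℤ} (h : x ≡ y [ZMOD ((3 * N : ℕ) : ℤ)])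
    (hxy : y - x = 3 * (b - a)) : a ≡ b [ZMOD N] := by
  rw [Int.modEq_iff_dvd] at h ⊢
  rw [hxy, Nat.cast_mul] at h
  exact Int.dvd_of_mul_dvd_mul_left (by norm_num) h

lemma modEq_three_of_three_mul {N : ℕ} {x y : ℤ} (h : x ≡ y [ZMOD ((3 * N : ℕ) : ℤ)]) :
    x ≡ y [ZMOD 3] :=
  h.of_dvd ⟨(N : ℤ), by push_cast; ring⟩

theorem threeFreeCovering_tripleUnion {N : ℕ} {A S : Finset ℕ} (hA : ThreeFreeCovering N A)
    (hS : ThreeFreeCovering N S) (hAS : CrossCovering N A S) :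
    ThreeFreeCovering (3 * N) (tripleUnion A S) := by
  refine ⟨?_, fun z => ?_⟩
  · intro x hx y hy z hz h
    have h3 := modEq_three_of_three_mul h
    unfold Int.ModEq at h3
    rw [Finset.mem_coe, mem_tripleUnion] at hx hy hz
    rcases hx with ⟨x, hx, rfl⟩ | ⟨x, hx, rfl⟩ <;> rcases hy with ⟨y, hy, rfl⟩ | ⟨y, hy, rfl⟩ <;>
      rcases hz with ⟨z, hz, rfl⟩ | ⟨z, hz, rfl⟩ <;> try omega
    · have := hA.1 x hx y hy z hz (modEq_of_three_mul h (by push_cast; ring))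
      omega
    · have := hS.1 x hx y hy z hz (modEq_of_three_mul h (by push_cast; ring))
      omega
  · obtain ⟨v, hv | hv | hv⟩ : ∃ v, z = 3 * v ∨ z = 3 * v + 1 ∨ z = 3 * v + 2 :=
      ⟨z / 3, by omega⟩
    · obtain ⟨x, hx, y, hy, hxy, h⟩ := hA.2 v
      exact ⟨3 * x, mem_tripleUnion.2 (.inl ⟨x, hx, rfl⟩), 3 * y,
        mem_tripleUnion.2 (.inl ⟨y, hy, rfl⟩), by omega,
        modEq_three_mul h (by rw [hv]; push_cast; ring)⟩
    · obtain ⟨x, hx, y, hy, hxy, h⟩ := hS.2 v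
      exact ⟨3 * x + 1, mem_tripleUnion.2 (.inr ⟨x, hx, rfl⟩), 3 * y + 1,
        mem_tripleUnion.2 (.inr ⟨y, hy, rfl⟩), by omega,
        modEq_three_mul h (by rw [hv]; push_cast; ring)⟩
    · obtain ⟨a, ha, s, hs, has, h⟩ | ⟨a, ha, s, hs, has, h⟩ := hAS v
      · exact ⟨3 * a, mem_tripleUnion.2 (.inl ⟨a, ha, rfl⟩), 3 * s + 1,
          mem_tripleUnion.2 (.inr ⟨s, hs, rfl⟩), by omega,
          modEq_three_mul h (by rw [hv]; push_cast; ring)⟩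
      · exact ⟨3 * s + 1, mem_tripleUnion.2 (.inr ⟨s, hs, rfl⟩), 3 * a,
          mem_tripleUnion.2 (.inl ⟨a, ha, rfl⟩), by omega,
          modEq_three_mul h (by rw [hv]; push_cast; ring)⟩

theorem threeFreeCovering_tripleShift {N : ℕ} {S : Finset ℕ} (hS : ThreeFreeCovering N S) :
    ThreeFreeCovering (3 * N) (tripleShift S) := by
  refine ⟨?_, fun z => ?_⟩
  · intro x hx y hy z hz h
    have h3 := modEq_three_of_three_mul h
    unfold Int.ModEq at h3
    rw [Finset.mem_coe, mem_tripleShift] at hx hy hz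
    rcases hx with ⟨x, hx, rfl⟩ | ⟨x, hx, rfl⟩ <;> rcases hy with ⟨y, hy, rfl⟩ | ⟨y, hy, rfl⟩ <;>
      rcases hz with ⟨z, hz, rfl⟩ | ⟨z, hz, rfl⟩ <;> try omega
    all_goals
      have := hS.1 x hx y hy z hz (modEq_of_three_mul h (by push_cast; ring))
      omega
  · obtain ⟨v, hv | hv | hv⟩ : ∃ v, z = 3 * v + 3 ∨ z = 3 * v + 1 ∨ z = 3 * v + 5 :=
      if h : z % 3 = 2 then ⟨z / 3 - 1, by omega⟩ else
      if h : z % 3 = 0 then ⟨z / 3 - 1, by omega⟩ else ⟨z / 3, by omega⟩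
    all_goals obtain ⟨x, hx, y, hy, hxy, h⟩ := hS.2 v
    · exact ⟨3 * x + 3, mem_tripleShift.2 (.inl ⟨x, hx, rfl⟩), 3 * y + 3,
        mem_tripleShift.2 (.inl ⟨y, hy, rfl⟩), by omega,
        modEq_three_mul h (by rw [hv]; push_cast; ring)⟩
    · exact ⟨3 * x + 1, mem_tripleShift.2 (.inr ⟨x, hx, rfl⟩), 3 * y + 1,
        mem_tripleShift.2 (.inr ⟨y, hy, rfl⟩), by omega,
        modEq_three_mul h (by rw [hv]; push_cast; ring)⟩
    · exact ⟨3 * x + 1, mem_tripleShift.2 (.inr ⟨x, hx, rfl⟩), 3 * y + 3,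
        mem_tripleShift.2 (.inl ⟨y, hy, rfl⟩), by omega,
        modEq_three_mul h (by rw [hv]; push_cast; ring)⟩

/-- Cross covering holds automatically after two steps. -/
theorem crossCovering_tripleUnion_tripleShift {N : ℕ} {S : Finset ℕ} (hS : ThreeFreeCovering N S)
    (A : Finset ℕ) :
    CrossCovering (3 * (3 * N)) (tripleUnion (tripleUnion A S) (tripleShift S))
      (tripleShift (tripleShift S)) := by
  have hT := threeFreeCovering_tripleShift hS
  have memA {s} (hs : s ∈ tripleShift S) : 3 * s + 1 ∈
      tripleUnion (tripleUnion A S) (tripleShift S) :=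
    mem_tripleUnion.2 (.inr ⟨s, hs, rfl⟩)
  have memA' {s} (hs : s ∈ S) : 3 * (3 * s + 1) ∈
      tripleUnion (tripleUnion A S) (tripleShift S) :=
    mem_tripleUnion.2 (.inl ⟨_, mem_tripleUnion.2 (.inr ⟨s, hs, rfl⟩), rfl⟩)
  have memT {T : Finset ℕ} {s} (hs : s ∈ T) : 3 * s + 3 ∈ tripleShift T :=
    mem_tripleShift.2 (.inl ⟨s, hs, rfl⟩)
  have memT' {T : Finset ℕ} {s} (hs : s ∈ T) : 3 * s + 1 ∈ tripleShift T :=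
    mem_tripleShift.2 (.inr ⟨s, hs, rfl⟩)
  intro z
  obtain ⟨v, hv | hv | hv⟩ : ∃ v, z = 3 * v ∨ z = 3 * v + 1 ∨ z = 3 * v + 5 :=
    if h : z % 3 = 2 then ⟨z / 3 - 1, by omega⟩ else ⟨z / 3, by omega⟩
  all_goals obtain ⟨x, hx, y, hy, hxy, h⟩ := hT.2 v
  · obtain hlt | rfl := hxy.lt_or_eq
    · exact .inr ⟨_, memA hy, _, memT' hx, by omega,
        modEq_three_mul h (by rw [hv]; push_cast; ring)⟩
    · left
      obtain ⟨s, hs, rfl⟩ | ⟨s, hs, rfl⟩ := mem_tripleShift.1 hx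
      · exact ⟨_, memA' hs, _, memT (memT' hs), by omega,
          modEq_three_mul h (by rw [hv]; push_cast; ring)⟩
      · obtain ⟨a, ha, b, hb, hab, h'⟩ := hS.2 ((s : ℤ) - 2)
        have hy : 2 * (3 * (b : ℤ) + 3) + 1 - 3 * a ≡ v [ZMOD (3 * N : ℕ)] :=
          (modEq_three_mul h' (by push_cast; ring)).trans h
        exact ⟨_, memA' ha, _, memT (memT hb), by omega,
          modEq_three_mul hy (by rw [hv]; push_cast; ring)⟩
  · exact .inl ⟨_, memA hx, _, memT' hy, by omega,
      modEq_three_mul h (by rw [hv]; push_cast; ring)⟩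
  · exact .inl ⟨_, memA hx, _, memT hy, by omega,
      modEq_three_mul h (by rw [hv]; push_cast; ring)⟩

/-- Iterating `(A, S) ↦ (tripleUnion A S, tripleShift S)` from suitable initial data. -/
theorem exists_nearModular_of_base {N M : ℕ} {A S : Finset ℕ} (hA : NearModular N A)
    (hS : ThreeFreeCovering N S) (hAS : CrossCovering N A S)
    (hAS' : CrossCovering (3 * N) (tripleUnion A S) (tripleShift S))
    (hM : M ∈ A) (hAM : ∀ a ∈ A, a ≤ M) (hSM : ∀ s ∈ S, s + 2 ≤ M) (n : ℕ) :
    ∃ B : Finset ℕ, NearModular (N * 3 ^ n) B ∧ M * 3 ^ n ∈ B ∧ ∀ b ∈ B, b ≤ M * 3 ^ n := by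
  induction n generalizing N M A S with
  | zero => exact ⟨A, by simpa using ⟨hA, hM, hAM⟩⟩
  | succ n ih =>
    have hB := threeFreeCovering_tripleUnion (A := A) hA.2 hS hAS
    obtain ⟨B, h⟩ := ih (N := 3 * N) (M := 3 * M) (A := tripleUnion A S) (S := tripleShift S)
      ⟨mem_tripleUnion.2 (.inl ⟨0, hA.1, rfl⟩), hB⟩ (threeFreeCovering_tripleShift hS) hAS' (crossCovering_tripleUnion_tripleShift hS A)
      (mem_tripleUnion.2 (.inl ⟨M, hM, rfl⟩))
      (fun b hb => by
        obtain ⟨a, ha, rfl⟩ | ⟨s, hs, rfl⟩ := mem_tripleUnion.1 hb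
        · have := hAM a ha; omega
        · have := hSM s hs; omega)
      (fun b hb => by
        obtain ⟨s, hs, rfl⟩ | ⟨s, hs, rfl⟩ := mem_tripleShift.1 hb <;>
        · have := hSM s hs; omega)
    refine ⟨B, ?_⟩
    rwa [show N * 3 ^ (n + 1) = 3 * N * 3 ^ n by ring,
      show M * 3 ^ (n + 1) = 3 * M * 3 ^ n by ring]

lemma threeFreeCovering_of_forall_lt {N : ℕ} (hN : 0 < N) {S : Finset ℕ}
    (hfree : ∀ x ∈ S, ∀ y ∈ S, ∀ z ∈ S, (x + z) % N = (2 * y) % N → x = y ∧ y = z)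
    (hcov : ∀ z < N, ∃ x ∈ S, ∃ y ∈ S, x ≤ y ∧ (2 * y - x) % N = z) :
    ThreeFreeCovering N S := by
  refine ⟨fun x hx y hy z hz h => hfree x hx y hy z hz ?_, fun z => ?_⟩
  · exact (Int.natCast_modEq_iff (n := N)).1 (by push_cast; exact h)
  · have hz := Int.emod_nonneg z (b := N) (by omega)
    have hz' := Int.emod_lt_of_pos z (b := N) (by omega)
    obtain ⟨x, hx, y, hy, hxy, h⟩ := hcov (z % N).toNat (by omega)
    refine ⟨x, hx, y, hy, hxy, ?_⟩
    have h' : (((2 * y - x) % N : ℕ) : ℤ) = z % N := by rw [h]; omega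
    rwa [Int.natCast_mod, Nat.cast_sub (by omega), Nat.cast_mul] at h'

lemma crossCovering_of_forall_lt {N : ℕ} (hN : 0 < N) {A S : Finset ℕ}
    (hcov : ∀ z < N, (∃ a ∈ A, ∃ s ∈ S, a ≤ s ∧ (2 * s - a) % N = z) ∨
      ∃ a ∈ A, ∃ s ∈ S, s < a ∧ (2 * a - s - 1) % N = z) :
    CrossCovering N A S := by
  intro z
  have hz := Int.emod_nonneg z (b := N) (by omega)
  have hz' := Int.emod_lt_of_pos z (b := N) (by omega)
  obtain ⟨a, ha, s, hs, has, h⟩ | ⟨a, ha, s, hs, has, h⟩ := hcov (z % N).toNat (by omega)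
  · refine .inl ⟨a, ha, s, hs, has, ?_⟩
    have h' : (((2 * s - a) % N : ℕ) : ℤ) = z % N := by rw [h]; omega
    rwa [Int.natCast_mod, Nat.cast_sub (by omega), Nat.cast_mul] at h'
  · refine .inr ⟨a, ha, s, hs, has, ?_⟩
    have h' : (((2 * a - s - 1) % N : ℕ) : ℤ) = z % N := by rw [h]; omega
    rwa [Int.natCast_mod, Nat.cast_sub (by omega), Nat.cast_sub (by omega), Nat.cast_mul,
      Nat.cast_one] at h'

theorem exists_nearModular_four (n : ℕ) :
    ∃ B : Finset ℕ, NearModular (3 * 3 ^ n) B ∧ 4 * 3 ^ n ∈ B ∧ ∀ b ∈ B, b ≤ 4 * 3 ^ n :=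
  exists_nearModular_of_base (A := {0, 4}) (S := {0, 2})
    ⟨by decide, threeFreeCovering_of_forall_lt (by decide) (by decide) (by decide)⟩
    (threeFreeCovering_of_forall_lt (by decide) (by decide) (by decide))
    (crossCovering_of_forall_lt (by decide) (by decide))
    (crossCovering_of_forall_lt (by decide) (by decide +kernel))
    (by decide) (by decide) (by decide) n

theorem exists_nearModular_eighteen (n : ℕ) :
    ∃ B : Finset ℕ, NearModular (27 * 3 ^ n) B ∧ 18 * 3 ^ n ∈ B ∧ ∀ b ∈ B, b ≤ 18 * 3 ^ n :=
  exists_nearModular_of_base (A := {0, 1, 6, 7, 10, 15, 16, 18})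
    (S := {0, 1, 3, 4, 9, 10, 12, 13})
    ⟨by decide, threeFreeCovering_of_forall_lt (by decide) (by decide +kernel)
      (by decide +kernel)⟩
    (threeFreeCovering_of_forall_lt (by decide) (by decide +kernel) (by decide +kernel))
    (crossCovering_of_forall_lt (by decide) (by decide +kernel))
    (crossCovering_of_forall_lt (by decide) (by decide +kernel))
    (by decide) (by decide) (by decide) n

theorem exists_nearModular_two (n : ℕ) :
    ∃ B : Finset ℕ, NearModular (3 * 3 ^ n) B ∧ 2 * 3 ^ n ∈ B ∧ ∀ b ∈ B, b ≤ 2 * 3 ^ n := by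
  match n with
  | 0 =>
    exact ⟨{0, 2}, ⟨by decide, threeFreeCovering_of_forall_lt (by decide) (by decide) (by decide)⟩,
      by decide, by decide⟩
  | 1 =>
    exact ⟨{0, 2, 5, 6}, ⟨by decide,
      threeFreeCovering_of_forall_lt (by decide) (by decide +kernel) (by decide +kernel)⟩,
      by decide, by decide⟩
  | n + 2 =>
    rw [show 3 * 3 ^ (n + 2) = 27 * 3 ^ n by ring, show 2 * 3 ^ (n + 2) = 18 * 3 ^ n by ring]
    exact exists_nearModular_eighteen n

/-- The maximum of a near-modular set may be increased by any multiple of the modulus. -/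
theorem NearModular.exists_add_mul {N M : ℕ} {A : Finset ℕ} (hA : NearModular N A) (hM0 : 0 < M)
    (hM : M ∈ A) (hAM : ∀ a ∈ A, a ≤ M) (c : ℕ) :
    ∃ B : Finset ℕ, NearModular N B ∧ M + c * N ∈ B ∧ ∀ b ∈ B, b ≤ M + c * N := by
  set f : ℕ → ℕ := fun a => if a = M then M + c * N else a with hf
  have hmod (a : ℕ) : (f a : ℤ) ≡ a [ZMOD N] := by
    by_cases h : a = M
    · simp [hf, h, Int.modEq_iff_dvd]
    · simp [hf, h]
  refine ⟨A.image f, ⟨?_, ?_, fun z => ?_⟩, ?_, ?_⟩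
  · exact Finset.mem_image.2 ⟨0, hA.1, by simp [hf, hM0.ne]⟩
  · rintro x hx y hy z hz h
    obtain ⟨x, hx', rfl⟩ := Finset.mem_image.1 hx
    obtain ⟨y, hy', rfl⟩ := Finset.mem_image.1 hy
    obtain ⟨z, hz', rfl⟩ := Finset.mem_image.1 hz
    obtain ⟨rfl, rfl⟩ := hA.2.1 x hx' y hy' z hz'
      ((((hmod x).add (hmod z)).symm.trans h).trans ((hmod y).mul_left 2))
    exact ⟨rfl, rfl⟩
  · obtain ⟨x, hx, y, hy, hxy, h⟩ := hA.2.2 z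
    refine ⟨f x, Finset.mem_image_of_mem f hx, f y, Finset.mem_image_of_mem f hy, ?_,
      (((hmod y).mul_left 2).sub (hmod x)).trans h⟩
    have := hAM y hy
    simp only [hf]
    split_ifs <;> omega
  · exact Finset.mem_image.2 ⟨M, hM, by simp [hf]⟩
  · intro b hb
    obtain ⟨a, ha, rfl⟩ := Finset.mem_image.1 hb
    have := hAM a ha
    simp only [hf]
    split_ifs <;> omega

theorem nearModular_exists_max (t : ℕ) (ht : 0 < t) (k : ℕ) (hk : 2 ≤ k) (hk3 : ¬ 3 ∣ k) :
    ∃ A : Finset ℕ, ∃ h : A.Nonempty,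
      NearModular (3 ^ t) A ∧ A.max' h = k * 3 ^ (t - 1) := by
  obtain ⟨n, rfl⟩ : ∃ n, t = n + 1 := ⟨t - 1, by omega⟩
  have base : ∃ k₀ c, 0 < k₀ ∧ k = k₀ + c * 3 ∧ ∃ B : Finset ℕ, NearModular (3 * 3 ^ n) B ∧
      k₀ * 3 ^ n ∈ B ∧ ∀ b ∈ B, b ≤ k₀ * 3 ^ n := by
    by_cases h : k % 3 = 2
    · exact ⟨2, k / 3, by omega, by omega, exists_nearModular_two n⟩
    · exact ⟨4, k / 3 - 1, by omega, by omega, exists_nearModular_four n⟩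
  obtain ⟨k₀, c, hk₀, rfl, B, hB, hmem, hle⟩ := base
  obtain ⟨A, hA, hmax, hle⟩ := hB.exists_add_mul (by positivity) hmem hle c
  rw [show k₀ * 3 ^ n + c * (3 * 3 ^ n) = (k₀ + c * 3) * 3 ^ n by ring] at hmax hle
  refine ⟨A, ⟨_, hmax⟩, by rwa [pow_succ'], ?_⟩
  exact le_antisymm (Finset.max'_le _ _ _ hle) (Finset.le_max' _ _ hmax)
end

section
/- For every positive integer t, there exists a modular set A modulo 3^t with |A| = 2^t and maximum element 2·3^{t−1}. -/
/-- The set `3 A ∪ (3 B + d)`. -/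
def interleave (d : ℕ) (A B : Finset ℕ) : Finset ℕ :=
  A.image (3 * ·) ∪ B.image (3 * · + d)

/-- The nonnegative integers with `n` ternary digits, all of them `0` or `1`. -/
def binaryDigits : ℕ → Finset ℕ
  | 0 => {0}
  | n + 1 => interleave 1 (binaryDigits n) (binaryDigits n)

/-- A modular set modulo `3 ^ n` of the prescribed size and maximum which, together with
`binaryDigits n`, covers all residues in the ways needed to pass from `n` to `n + 1`. -/
structure Extendable (n : ℕ) (A : Finset ℕ) : Prop where
  zero_mem : 0 ∈ A
  threeFree : ThreeFreeMod (3 ^ n) ↑A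
  covers : ∀ z : ℤ, ModCovered (3 ^ n) ↑A z
  card : A.card = 2 ^ n
  max_mem : 2 * 3 ^ (n - 1) ∈ A
  le_max : ∀ a ∈ A, a ≤ 2 * 3 ^ (n - 1)
  shifted : ∀ z : ℤ, ∃ u ∈ A, ∃ v ∈ binaryDigits n,
    (u ≤ v ∧ 2 * (v : ℤ) - u + 1 ≡ z [ZMOD (3 ^ n : ℕ)]) ∨
      (v < u ∧ 2 * (u : ℤ) - v - 1 ≡ z [ZMOD (3 ^ n : ℕ)])
  mixed : ∀ z : ℤ, ∃ u ∈ A, ∃ v ∈ binaryDigits n,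
    (u ≤ v ∧ 2 * (v : ℤ) - u ≡ z [ZMOD (3 ^ n : ℕ)]) ∨
      (v < u ∧ 2 * (u : ℤ) - v - 1 ≡ z [ZMOD (3 ^ n : ℕ)])
  strict : ∀ z : ℤ, ∃ v ∈ binaryDigits n,
    (∃ u ∈ binaryDigits n, u < v ∧ 2 * (v : ℤ) - u ≡ z [ZMOD (3 ^ n : ℕ)]) ∨
      (∃ u ∈ A, v < u ∧ 2 * (u : ℤ) - v ≡ z [ZMOD (3 ^ n : ℕ)])

theorem mem_interleave {d : ℕ} {A B : Finset ℕ} {x : ℕ} :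
    x ∈ interleave d A B ↔ (∃ a ∈ A, 3 * a = x) ∨ ∃ b ∈ B, 3 * b + d = x := by
  simp [interleave]

theorem mul_three_mem_interleave {d : ℕ} {A B : Finset ℕ} {a : ℕ} (ha : a ∈ A) :
    3 * a ∈ interleave d A B :=
  mem_interleave.2 (.inl ⟨a, ha, rfl⟩)

theorem mul_three_add_mem_interleave {d : ℕ} {A B : Finset ℕ} {b : ℕ} (hb : b ∈ B) :
    3 * b + d ∈ interleave d A B :=
  mem_interleave.2 (.inr ⟨b, hb, rfl⟩)

theorem card_interleave {d : ℕ} (hd : ¬ 3 ∣ d) (A B : Finset ℕ) :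
    (interleave d A B).card = A.card + B.card := by
  rw [interleave, Finset.card_union_of_disjoint, Finset.card_image_of_injective,
    Finset.card_image_of_injective]
  · intro a b h
    dsimp only at h
    omega
  · intro a b h
    dsimp only at h
    omega
  · rw [Finset.disjoint_left]
    simp only [Finset.mem_image, not_exists, not_and]
    rintro _ ⟨a, -, rfl⟩ b - h
    omega

theorem threeFreeMod_interleave {n d : ℕ} (hd : ¬ 3 ∣ d) {A B : Finset ℕ}
    (hA : ThreeFreeMod (3 ^ n) ↑A) (hB : ThreeFreeMod (3 ^ n) ↑B) :
    ThreeFreeMod (3 ^ (n + 1)) ↑(interleave d A B) := by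
  intro x hx y hy z hz h
  obtain ⟨k, hk⟩ := h.dvd
  push_cast [pow_succ] at hk
  have hd' : ¬ (3 : ℤ) ∣ d := by omega
  have of_dvd {a b c : ℕ} (e : (2 * b - (a + c) : ℤ) = 3 ^ n * k) :
      (a : ℤ) + c ≡ 2 * b [ZMOD (3 ^ n : ℕ)] :=
    Int.modEq_iff_dvd.2 ⟨k, by push_cast; exact e⟩
  have hk3 : 2 * (y : ℤ) - (x + z) = 3 * (3 ^ n * k) := by rw [hk]; ring
  simp only [Finset.mem_coe, mem_interleave] at hx hy hz
  generalize hm : (3 : ℤ) ^ n * k = m at *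
  obtain ⟨a, ha, rfl⟩ | ⟨a, ha, rfl⟩ := hx <;> obtain ⟨b, hb, rfl⟩ | ⟨b, hb, rfl⟩ := hy <;>
    obtain ⟨c, hc, rfl⟩ | ⟨c, hc, rfl⟩ := hz <;> push_cast at hk3
  · have := hA a ha b hb c hc (of_dvd (by omega))
    omega
  · omega
  · omega
  · omega
  · omega
  · omega
  · omega
  · have := hB a ha b hb c hc (of_dvd (by omega))
    omega

theorem modEq_pow_succ_of_digit {n : ℕ} {e w f z : ℤ} (r : ℤ) (h : e ≡ w [ZMOD (3 ^ n : ℕ)])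
    (hf : f = 3 * e + r) (hz : z = 3 * w + r) : f ≡ z [ZMOD (3 ^ (n + 1) : ℕ)] := by
  rw [hf, hz]
  have := (h.mul_left' (c := 3)).add_right r
  rwa [show (3 : ℤ) * (3 ^ n : ℕ) = (3 ^ (n + 1) : ℕ) by push_cast; ring] at this

theorem exists_ternary_digit (z : ℤ) :
    (∃ w, z = 3 * w) ∨ (∃ w, z = 3 * w + 1) ∨ ∃ w, z = 3 * w + 2 := by
  have : z = 3 * (z / 3) ∨ z = 3 * (z / 3) + 1 ∨ z = 3 * (z / 3) + 2 := by omega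
  exact this.imp (⟨_, ·⟩) (Or.imp (⟨_, ·⟩) (⟨_, ·⟩))

theorem card_binaryDigits (n : ℕ) : (binaryDigits n).card = 2 ^ n := by
  induction n with
  | zero => rfl
  | succ n ih => rw [binaryDigits, card_interleave (by norm_num), ih]; ring

theorem threeFreeMod_binaryDigits (n : ℕ) : ThreeFreeMod (3 ^ n) ↑(binaryDigits n) := by
  induction n with
  | zero => simp [ThreeFreeMod, binaryDigits]
  | succ n ih => exact threeFreeMod_interleave (by norm_num) ih ih

theorem two_mul_lt_of_mem_binaryDigits {n c : ℕ} (hc : c ∈ binaryDigits n) : 2 * c < 3 ^ n := by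
  induction n generalizing c with
  | zero => simp_all [binaryDigits]
  | succ n ih =>
    rw [binaryDigits, mem_interleave] at hc
    obtain ⟨a, ha, rfl⟩ | ⟨a, ha, rfl⟩ := hc <;> have := ih ha <;> omega

theorem modCovered_binaryDigits (n : ℕ) (z : ℤ) : ModCovered (3 ^ n) ↑(binaryDigits n) z := by
  induction n generalizing z with
  | zero =>
    exact ⟨0, by simp [binaryDigits], 0, by simp [binaryDigits], le_rfl, by simp [Int.modEq_one]⟩
  | succ n ih =>
    obtain ⟨w, hw⟩ | ⟨w, hw⟩ | ⟨w, hw⟩ := exists_ternary_digit z <;>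
      obtain ⟨a, ha, b, hb, hab, h⟩ := ih w
    · exact ⟨_, mul_three_mem_interleave ha, _, mul_three_mem_interleave hb, by omega,
        modEq_pow_succ_of_digit 0 h (by push_cast; ring) (by omega)⟩
    · exact ⟨_, mul_three_add_mem_interleave ha, _, mul_three_add_mem_interleave hb, by omega,
        modEq_pow_succ_of_digit 1 h (by push_cast; ring) hw⟩
    · exact ⟨_, mul_three_mem_interleave ha, _, mul_three_add_mem_interleave hb, by omega,
        modEq_pow_succ_of_digit 2 h (by push_cast; ring) hw⟩

theorem Extendable.modularSet {n : ℕ} {A : Finset ℕ} (hn : 0 < n) (h : Extendable n A) :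
    ModularSet (3 ^ n) A := by
  refine ⟨⟨h.zero_mem, h.threeFree, h.covers⟩, fun a ha ↦ (h.le_max a ha).trans_lt ?_⟩
  obtain ⟨m, rfl⟩ := Nat.exists_eq_succ_of_ne_zero hn.ne'
  have : 0 < 3 ^ m := by positivity
  rw [Nat.succ_sub_one, pow_succ]
  omega

theorem Extendable.interleave {n : ℕ} {A : Finset ℕ} (hn : 0 < n) (h : Extendable n A) :
    Extendable (n + 1) (interleave 2 A (binaryDigits n)) where
  zero_mem := mul_three_mem_interleave h.zero_mem
  threeFree := threeFreeMod_interleave (by norm_num) h.threeFree (threeFreeMod_binaryDigits n)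
  covers z := by
    obtain ⟨w, hw⟩ | ⟨w, hw⟩ | ⟨w, hw⟩ := exists_ternary_digit z
    · obtain ⟨a, ha, b, hb, hab, e⟩ := h.covers w
      exact ⟨_, mul_three_mem_interleave ha, _, mul_three_mem_interleave hb, by omega,
        modEq_pow_succ_of_digit 0 e (by push_cast; ring) (by omega)⟩
    · obtain ⟨u, hu, v, hv, ⟨huv, e⟩ | ⟨huv, e⟩⟩ := h.shifted w
      · exact ⟨_, mul_three_mem_interleave hu, _, mul_three_add_mem_interleave hv, by omega,
          modEq_pow_succ_of_digit 1 e (by push_cast; ring) hw⟩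
      · exact ⟨_, mul_three_add_mem_interleave hv, _, mul_three_mem_interleave hu, by omega,
          modEq_pow_succ_of_digit 1 e (by push_cast; ring) hw⟩
    · obtain ⟨a, ha, b, hb, hab, e⟩ := modCovered_binaryDigits n w
      exact ⟨_, mul_three_add_mem_interleave ha, _, mul_three_add_mem_interleave hb, by omega,
        modEq_pow_succ_of_digit 2 e (by push_cast; ring) hw⟩
  card := by rw [card_interleave (by norm_num), h.card, card_binaryDigits]; ring
  max_mem := by
    obtain ⟨m, rfl⟩ := Nat.exists_eq_succ_of_ne_zero hn.ne'
    have := mul_three_mem_interleave (d := 2) (B := binaryDigits (m + 1)) h.max_mem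
    convert this using 1
    simp only [Nat.succ_eq_add_one, Nat.add_sub_cancel]
    ring
  le_max x hx := by
    obtain ⟨m, rfl⟩ := Nat.exists_eq_succ_of_ne_zero hn.ne'
    have hpow : 0 < 3 ^ m := by positivity
    rw [mem_interleave] at hx
    simp only [Nat.succ_eq_add_one, Nat.add_sub_cancel, pow_succ] at hx ⊢
    obtain ⟨a, ha, rfl⟩ | ⟨a, ha, rfl⟩ := hx
    · have := h.le_max a ha
      simp only [Nat.succ_eq_add_one, Nat.add_sub_cancel] at this
      omega
    · have := two_mul_lt_of_mem_binaryDigits ha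
      rw [pow_succ] at this
      omega
  shifted z := by
    obtain ⟨w, hw⟩ | ⟨w, hw⟩ | ⟨w, hw⟩ := exists_ternary_digit z
    · obtain ⟨b, hb, a, ha, hab, e⟩ := modCovered_binaryDigits n (w - 1)
      exact ⟨_, mul_three_add_mem_interleave ha, _, mul_three_mem_interleave hb,
        .inr ⟨by omega, modEq_pow_succ_of_digit 3 e (by push_cast; ring) (by omega)⟩⟩
    · obtain ⟨u, hu, v, hv, ⟨huv, e⟩ | ⟨huv, e⟩⟩ := h.mixed w
      · exact ⟨_, mul_three_mem_interleave hu, _, mul_three_mem_interleave hv,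
          .inl ⟨by omega, modEq_pow_succ_of_digit 1 e (by push_cast; ring) hw⟩⟩
      · exact ⟨_, mul_three_mem_interleave hu, _, mul_three_add_mem_interleave hv,
          .inr ⟨by omega, modEq_pow_succ_of_digit 1 e (by push_cast; ring) hw⟩⟩
    · obtain ⟨b, hb, a, ha, hab, e⟩ := modCovered_binaryDigits n w
      exact ⟨_, mul_three_add_mem_interleave ha, _, mul_three_add_mem_interleave hb,
        .inr ⟨by omega, modEq_pow_succ_of_digit 2 e (by push_cast; ring) hw⟩⟩
  mixed z := by
    obtain ⟨w, hw⟩ | ⟨w, hw⟩ | ⟨w, hw⟩ := exists_ternary_digit z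
    · obtain ⟨b, hb, a, ha, hab, e⟩ := modCovered_binaryDigits n (w - 1)
      exact ⟨_, mul_three_add_mem_interleave ha, _, mul_three_mem_interleave hb,
        .inr ⟨by omega, modEq_pow_succ_of_digit 3 e (by push_cast; ring) (by omega)⟩⟩
    · obtain ⟨v, hv, ⟨u, hu, huv, e⟩ | ⟨u, hu, huv, e⟩⟩ := h.strict (w + 1)
      · exact ⟨_, mul_three_add_mem_interleave hu, _, mul_three_mem_interleave hv,
          .inl ⟨by omega, modEq_pow_succ_of_digit (-2) e (by push_cast; ring) (by omega)⟩⟩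
      · exact ⟨_, mul_three_mem_interleave hu, _, mul_three_add_mem_interleave hv,
          .inr ⟨by omega, modEq_pow_succ_of_digit (-2) e (by push_cast; ring) (by omega)⟩⟩
    · obtain ⟨u, hu, v, hv, ⟨huv, e⟩ | ⟨huv, e⟩⟩ := h.mixed w
      · exact ⟨_, mul_three_mem_interleave hu, _, mul_three_add_mem_interleave hv,
          .inl ⟨by omega, modEq_pow_succ_of_digit 2 e (by push_cast; ring) hw⟩⟩
      · exact ⟨_, mul_three_mem_interleave hu, _, mul_three_mem_interleave hv,
          .inr ⟨by omega, modEq_pow_succ_of_digit 2 e (by push_cast; ring) hw⟩⟩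
  strict z := by
    obtain ⟨w, hw⟩ | ⟨w, hw⟩ | ⟨w, hw⟩ := exists_ternary_digit z
    · obtain ⟨b, hb, a, ha, hab, e⟩ := modCovered_binaryDigits n (w - 1)
      exact ⟨_, mul_three_add_mem_interleave hb, .inr ⟨_, mul_three_add_mem_interleave ha,
        by omega, modEq_pow_succ_of_digit 3 e (by push_cast; ring) (by omega)⟩⟩
    · obtain ⟨b, hb, a, ha, hab, e⟩ := modCovered_binaryDigits n (w - 1)
      exact ⟨_, mul_three_mem_interleave hb, .inr ⟨_, mul_three_add_mem_interleave ha,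
        by omega, modEq_pow_succ_of_digit 4 e (by push_cast; ring) (by omega)⟩⟩
    · obtain ⟨a, ha, b, hb, hab, e⟩ := modCovered_binaryDigits n w
      exact ⟨_, mul_three_add_mem_interleave hb, .inl ⟨_, mul_three_mem_interleave ha,
        by omega, modEq_pow_succ_of_digit 2 e (by push_cast; ring) hw⟩⟩

theorem forall_int_of_forall_lt {N : ℕ} (hN : 0 < N) {p : ℤ → Prop}
    (hp : ∀ a b, a ≡ b [ZMOD N] → p a → p b) (h : ∀ r < N, p (r : ℕ)) (z : ℤ) : p z := by
  have h0 : 0 ≤ z % N := Int.emod_nonneg _ (by omega)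
  have h1 : z % N < N := Int.emod_lt_of_pos _ (by omega)
  refine hp (z % N).toNat z ?_ (h _ (by omega))
  rw [Int.toNat_of_nonneg h0]
  exact Int.mod_modEq _ _

theorem modCovered_of_forall_lt {N : ℕ} (hN : 0 < N) {A : Finset ℕ}
    (h : ∀ r < N, ∃ x ∈ A, ∃ y ∈ A, x ≤ y ∧ 2 * (y : ℤ) - x ≡ (r : ℕ) [ZMOD N]) (z : ℤ) :
    ModCovered N ↑A z := by
  refine forall_int_of_forall_lt hN ?_ h z
  rintro a b hab ⟨x, hx, y, hy, hxy, e⟩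
  exact ⟨x, hx, y, hy, hxy, e.trans hab⟩

theorem threeFreeMod_of_forall {N : ℕ} {A : Finset ℕ}
    (h : ∀ x ∈ A, ∀ y ∈ A, ∀ z ∈ A, (x : ℤ) + z ≡ 2 * y [ZMOD N] → x = y ∧ y = z) :
    ThreeFreeMod N ↑A := h

theorem extendable_three : Extendable 3 {0, 1, 6, 7, 10, 15, 16, 18} where
  zero_mem := by decide
  threeFree := threeFreeMod_of_forall (by decide +kernel)
  covers := modCovered_of_forall_lt (by norm_num) (by decide +kernel)
  card := by decide
  max_mem := by decide
  le_max := by decide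
  shifted := by
    refine forall_int_of_forall_lt (N := 3 ^ 3) (by norm_num) ?_ (by decide +kernel)
    rintro a b hab ⟨u, hu, v, hv, e⟩
    exact ⟨u, hu, v, hv, e.imp (.imp_right (·.trans hab)) (.imp_right (·.trans hab))⟩
  mixed := by
    refine forall_int_of_forall_lt (N := 3 ^ 3) (by norm_num) ?_ (by decide +kernel)
    rintro a b hab ⟨u, hu, v, hv, e⟩
    exact ⟨u, hu, v, hv, e.imp (.imp_right (·.trans hab)) (.imp_right (·.trans hab))⟩
  strict := by
    refine forall_int_of_forall_lt (N := 3 ^ 3) (by norm_num) ?_ (by decide +kernel)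
    rintro a b hab ⟨v, hv, ⟨u, hu, huv, e⟩ | ⟨u, hu, huv, e⟩⟩
    · exact ⟨v, hv, .inl ⟨u, hu, huv, e.trans hab⟩⟩
    · exact ⟨v, hv, .inr ⟨u, hu, huv, e.trans hab⟩⟩

theorem exists_extendable {n : ℕ} (hn : 3 ≤ n) : ∃ A, Extendable n A := by
  induction n, hn using Nat.le_induction with
  | base => exact ⟨_, extendable_three⟩
  | succ n hn ih => exact ih.imp' _ fun _ h ↦ h.interleave (by omega)

theorem modular_exists_A_t (t : ℕ) (ht : 0 < t) :
    ∃ A : Finset ℕ, ∃ h : A.Nonempty,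
      ModularSet (3 ^ t) A ∧ A.card = 2 ^ t ∧ A.max' h = 2 * 3 ^ (t - 1) := by
  obtain rfl | rfl | h3 : t = 1 ∨ t = 2 ∨ 3 ≤ t := by omega
  · refine ⟨{0, 2}, by simp, ⟨⟨by decide, threeFreeMod_of_forall (by decide),
      modCovered_of_forall_lt (by norm_num) (by decide)⟩, by decide⟩, by decide, by decide⟩
  · refine ⟨{0, 2, 5, 6}, by simp, ⟨⟨by decide, threeFreeMod_of_forall (by decide +kernel),
      modCovered_of_forall_lt (by norm_num) (by decide +kernel)⟩, by decide⟩, by decide,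
      by decide⟩
  · obtain ⟨A, hA⟩ := exists_extendable h3
    exact ⟨A, ⟨0, hA.zero_mem⟩, hA.modularSet ht, hA.card,
      le_antisymm (Finset.max'_le _ _ _ hA.le_max) (Finset.le_max' _ _ hA.max_mem)⟩
end

section
/- For every integer n ≥ 1, the set ℬ_n is a modular set modulo 3^{2n} with |ℬ_n| = 2^{2n} and maximum element 2·3^{2n−1}. -/
/-- `U 1 = {0, 2}` and `U (n+1) = {0, 2, 3, 5} + 9 · U n`. -/
def Uset : ℕ → Finset ℕ
  | 0 => {0}
  | 1 => {0, 2}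
  | n + 2 => Finset.image₂ (fun d x => d + 9 * x) ({0, 2, 3, 5} : Finset ℕ) (Uset (n + 1))

/-- `ℬ n = ((U n ∪ (U n + 3^(2n-1))) \ {3^(2n-1)}) ∪ {2 · 3^(2n-1)}`. -/
def Bset (n : ℕ) : Finset ℕ :=
  ((Uset n ∪ (Uset n).image (fun x => x + 3 ^ (2 * n - 1))) \ {3 ^ (2 * n - 1)})
    ∪ {2 * 3 ^ (2 * n - 1)}

/-- The `2 * n`-digit ternary numbers whose digits in even positions lie in `{0, 2}` and whose
digits in odd positions lie in `{0, 1}`. -/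
def Wset : ℕ → Finset ℕ
  | 0 => {0}
  | n + 1 => Finset.image₂ (fun d x => d + 9 * x) ({0, 2, 3, 5} : Finset ℕ) (Wset n)

lemma mem_Wset_succ {n w : ℕ} :
    w ∈ Wset (n + 1) ↔ ∃ d ∈ ({0, 2, 3, 5} : Finset ℕ), ∃ x ∈ Wset n, d + 9 * x = w := by
  rw [Wset, Finset.mem_image₂]

lemma add_mem_Wset_succ {n d x : ℕ} (hd : d ∈ ({0, 2, 3, 5} : Finset ℕ)) (hx : x ∈ Wset n) :
    d + 9 * x ∈ Wset (n + 1) :=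
  mem_Wset_succ.2 ⟨d, hd, x, hx, rfl⟩

lemma mem_Wset_iff_Uset (n w : ℕ) :
    w ∈ Wset (n + 1) ↔
      w ∈ Uset (n + 1) ∨ ∃ u ∈ Uset (n + 1), u + 3 ^ (2 * n + 1) = w := by
  induction n generalizing w with
  | zero => simp [Wset, Uset]; omega
  | succ n ih =>
    have hU : ∀ u, u ∈ Uset (n + 1 + 1) ↔
        ∃ d ∈ ({0, 2, 3, 5} : Finset ℕ), ∃ x ∈ Uset (n + 1), d + 9 * x = u := by
      intro u
      rw [Uset, Finset.mem_image₂]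
    have hp : 3 ^ (2 * (n + 1) + 1) = 9 * 3 ^ (2 * n + 1) := by ring
    rw [mem_Wset_succ, hp]
    constructor
    · rintro ⟨d, hd, x, hx, rfl⟩
      rcases (ih x).1 hx with hx | ⟨u, hu, rfl⟩
      · exact Or.inl ((hU _).2 ⟨d, hd, x, hx, rfl⟩)
      · exact Or.inr ⟨d + 9 * u, (hU _).2 ⟨d, hd, u, hu, rfl⟩, by ring⟩
    · rintro (h | ⟨u, h, rfl⟩)
      · obtain ⟨d, hd, x, hx, rfl⟩ := (hU _).1 h
        exact ⟨d, hd, x, (ih x).2 (Or.inl hx), rfl⟩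
      · obtain ⟨d, hd, x, hx, rfl⟩ := (hU _).1 h
        exact ⟨d, hd, _, (ih _).2 (Or.inr ⟨x, hx, rfl⟩), by ring⟩

lemma nine_pow_succ_eq (n : ℕ) : 9 ^ (n + 1) = 3 * 3 ^ (2 * n + 1) := by
  rw [show (9 : ℕ) = 3 ^ 2 by norm_num, ← pow_mul]; ring

lemma Bset_succ_eq (n : ℕ) :
    Bset (n + 1) =
      insert (2 * 3 ^ (2 * n + 1)) ((Wset (n + 1)).erase (3 ^ (2 * n + 1))) := by
  ext w
  have hp : 2 * (n + 1) - 1 = 2 * n + 1 := by omega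
  simp only [Bset, hp, Finset.mem_union, Finset.mem_sdiff, Finset.mem_image,
    Finset.mem_singleton, Finset.mem_insert, Finset.mem_erase, mem_Wset_iff_Uset, ne_eq]
  rw [or_comm, and_comm]

lemma mem_Bset_succ {n w : ℕ} :
    w ∈ Bset (n + 1) ↔
      (w ∈ Wset (n + 1) ∧ 3 * w ≠ 9 ^ (n + 1)) ∨ 3 * w = 2 * 9 ^ (n + 1) := by
  rw [Bset_succ_eq, Finset.mem_insert, Finset.mem_erase, nine_pow_succ_eq]
  have h1 : w = 2 * 3 ^ (2 * n + 1) ↔ 3 * w = 2 * (3 * 3 ^ (2 * n + 1)) := by omega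
  have h2 : w ≠ 3 ^ (2 * n + 1) ↔ 3 * w ≠ 3 * 3 ^ (2 * n + 1) := by omega
  rw [h1, h2]
  tauto

/-- The recursive description of `Bset` in base nine. -/
lemma mem_Bset_succ_succ {n w : ℕ} :
    w ∈ Bset (n + 1 + 1) ↔
      (∃ d ∈ ({2, 3, 5} : Finset ℕ), ∃ x ∈ Wset (n + 1), d + 9 * x = w) ∨
        ∃ x ∈ Bset (n + 1), 9 * x = w := by
  rw [mem_Bset_succ, mem_Wset_succ, pow_succ 9 (n + 1)]
  have h9 : 9 ^ (n + 1) = 9 * 9 ^ n := by ring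
  constructor
  · rintro (⟨⟨d, hd, x, hx, rfl⟩, hne⟩ | h)
    · by_cases h0 : d = 0
      · subst h0
        exact Or.inr ⟨x, mem_Bset_succ.2 (Or.inl ⟨hx, by omega⟩), by omega⟩
      · refine Or.inl ⟨d, ?_, x, hx, rfl⟩
        simp only [Finset.mem_insert, Finset.mem_singleton] at hd ⊢
        tauto
    · exact Or.inr ⟨w / 9, mem_Bset_succ.2 (Or.inr (by omega)), by omega⟩
  · rintro (⟨d, hd, x, hx, rfl⟩ | ⟨x, hx, rfl⟩)
    · simp only [Finset.mem_insert, Finset.mem_singleton] at hd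
      refine Or.inl ⟨⟨d, ?_, x, hx, rfl⟩, by omega⟩
      simp only [Finset.mem_insert, Finset.mem_singleton]
      tauto
    · rcases mem_Bset_succ.1 hx with ⟨hx, hne⟩ | h
      · exact Or.inl ⟨⟨0, by simp, x, hx, by omega⟩, by omega⟩
      · exact Or.inr (by omega)

lemma eight_mul_le_of_mem_Wset {n w : ℕ} (hw : w ∈ Wset n) : 8 * w + 5 ≤ 5 * 9 ^ n := by
  induction n generalizing w with
  | zero => simp [Wset] at hw; omega
  | succ n ih =>
    obtain ⟨d, hd, x, hx, rfl⟩ := mem_Wset_succ.1 hw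
    have := ih hx
    simp only [Finset.mem_insert, Finset.mem_singleton] at hd
    rw [pow_succ]
    omega

lemma card_Wset (n : ℕ) : (Wset n).card = 4 ^ n := by
  induction n with
  | zero => rfl
  | succ n ih =>
    have hi : Set.InjOn (fun p : ℕ × ℕ => p.1 + 9 * p.2)
        ((({0, 2, 3, 5} : Finset ℕ) : Set ℕ) ×ˢ (Wset n : Set ℕ)) := by
      rintro ⟨a, x⟩ ⟨ha, -⟩ ⟨b, y⟩ ⟨hb, -⟩ h
      simp only [Finset.mem_coe, Finset.mem_insert, Finset.mem_singleton] at ha hb h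
      ext <;> simp only <;> omega
    rw [Wset, Finset.card_image₂_iff.2 hi, ih, pow_succ, mul_comm]
    rfl

lemma zero_mem_Wset (n : ℕ) : 0 ∈ Wset n := by
  induction n with
  | zero => simp [Wset]
  | succ n ih => exact mem_Wset_succ.2 ⟨0, by simp, 0, ih, rfl⟩

lemma three_pow_mem_Wset (n : ℕ) : 3 ^ (2 * n + 1) ∈ Wset (n + 1) := by
  induction n with
  | zero => decide
  | succ n ih => exact mem_Wset_succ.2 ⟨0, by simp, _, ih, by ring⟩

lemma card_Bset_succ (n : ℕ) : (Bset (n + 1)).card = 4 ^ (n + 1) := by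
  have hnot : 2 * 3 ^ (2 * n + 1) ∉ Wset (n + 1) := by
    intro h
    have := eight_mul_le_of_mem_Wset h
    have := nine_pow_succ_eq n
    omega
  rw [Bset_succ_eq, Finset.card_insert_of_notMem (fun h => hnot (Finset.mem_of_mem_erase h)),
    Finset.card_erase_add_one (three_pow_mem_Wset n), card_Wset]

lemma three_mul_le_of_mem_Bset {n w : ℕ} (hw : w ∈ Bset (n + 1)) :
    3 * w ≤ 2 * 9 ^ (n + 1) := by
  rcases mem_Bset_succ.1 hw with ⟨h, -⟩ | h
  · have := eight_mul_le_of_mem_Wset h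
    omega
  · omega

lemma zero_mem_Bset (n : ℕ) : 0 ∈ Bset (n + 1) :=
  mem_Bset_succ.2 (Or.inl ⟨zero_mem_Wset _, by positivity⟩)

/-- A modular three-term progression modulo `9 ^ (n + 1)` has constant base-nine units digit when
these digits lie in `{0, 2, 3, 5}`, and the leading parts form a progression modulo `9 ^ n`. -/
lemma digit_eq_of_modEq {n a b c x y z : ℕ} (ha : a ∈ ({0, 2, 3, 5} : Finset ℕ))
    (hb : b ∈ ({0, 2, 3, 5} : Finset ℕ)) (hc : c ∈ ({0, 2, 3, 5} : Finset ℕ))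
    (h : ((a + 9 * x : ℕ) : ℤ) + ((c + 9 * z : ℕ) : ℤ) ≡
      2 * ((b + 9 * y : ℕ) : ℤ) [ZMOD ((9 ^ (n + 1) : ℕ) : ℤ)]) :
    a = b ∧ b = c ∧ (x : ℤ) + z ≡ 2 * y [ZMOD ((9 ^ n : ℕ) : ℤ)] := by
  obtain ⟨k, hk⟩ := h.dvd
  simp only [Finset.mem_insert, Finset.mem_singleton] at ha hb hc
  push_cast [pow_succ] at hk
  have h1 : 2 * ((b : ℤ) + 9 * y) - (a + 9 * x + (c + 9 * z)) = 9 * (9 ^ n * k) := by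
    rw [hk]; ring
  have hab : a = b ∧ b = c := by omega
  refine ⟨hab.1, hab.2, (Int.modEq_iff_dvd).2 ⟨k, ?_⟩⟩
  push_cast
  omega

lemma threeFreeMod_Wset (n : ℕ) : ThreeFreeMod (9 ^ n) (Wset n) := by
  induction n with
  | zero =>
    intro x hx y hy z hz _
    simp [Wset] at hx hy hz
    omega
  | succ n ih =>
    intro x hx y hy z hz h
    obtain ⟨a, ha, x, hx', rfl⟩ := mem_Wset_succ.1 hx
    obtain ⟨b, hb, y, hy', rfl⟩ := mem_Wset_succ.1 hy
    obtain ⟨c, hc, z, hz', rfl⟩ := mem_Wset_succ.1 hz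
    obtain ⟨rfl, rfl, h'⟩ := digit_eq_of_modEq ha hb hc h
    obtain ⟨rfl, rfl⟩ := ih x hx' y hy' z hz' h'
    exact ⟨rfl, rfl⟩

lemma threeFreeMod_Bset (n : ℕ) : ThreeFreeMod (9 ^ (n + 1)) (Bset (n + 1)) := by
  induction n with
  | zero =>
    intro x hx y hy z hz h
    have hB : Bset (0 + 1) = {0, 2, 5, 6} := by decide
    simp only [hB, Finset.coe_insert, Finset.coe_singleton, Set.mem_insert_iff,
      Set.mem_singleton_iff] at hx hy hz
    have h' := h.dvd
    norm_num at h'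
    omega
  | succ n ih =>
    have key : ∀ w ∈ Bset (n + 1 + 1), ∃ d ∈ ({0, 2, 3, 5} : Finset ℕ), ∃ x, d + 9 * x = w ∧
        (d = 0 → x ∈ Bset (n + 1)) ∧ (d ≠ 0 → x ∈ Wset (n + 1)) := by
      intro w hw
      rcases mem_Bset_succ_succ.1 hw with ⟨d, hd, x, hx, rfl⟩ | ⟨x, hx, rfl⟩
      · simp only [Finset.mem_insert, Finset.mem_singleton] at hd
        exact ⟨d, by simp only [Finset.mem_insert, Finset.mem_singleton]; tauto, x, rfl,
          by omega, fun _ => hx⟩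
      · exact ⟨0, by simp, x, by omega, fun _ => hx, by omega⟩
    intro x hx y hy z hz h
    obtain ⟨a, ha, x, rfl, hx0, hx1⟩ := key x hx
    obtain ⟨b, hb, y, rfl, hy0, hy1⟩ := key y hy
    obtain ⟨c, hc, z, rfl, hz0, hz1⟩ := key z hz
    obtain ⟨rfl, rfl, h'⟩ := digit_eq_of_modEq ha hb hc h
    by_cases h0 : a = 0
    · obtain ⟨rfl, rfl⟩ := ih x (hx0 h0) y (hy0 h0) z (hz0 h0) h'
      exact ⟨rfl, rfl⟩
    · obtain ⟨rfl, rfl⟩ :=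
        threeFreeMod_Wset (n + 1) x (hx1 h0) y (hy1 h0) z (hz1 h0) h'
      exact ⟨rfl, rfl⟩

lemma modEq_prepend_digit {n a b x y : ℕ} {z z' : ℤ}
    (h : 2 * (y : ℤ) - x ≡ z' [ZMOD ((9 ^ n : ℕ) : ℤ)]) (hz : 2 * (b : ℤ) - a + 9 * z' = z) :
    2 * ((b + 9 * y : ℕ) : ℤ) - ((a + 9 * x : ℕ) : ℤ) ≡ z
      [ZMOD ((9 ^ (n + 1) : ℕ) : ℤ)] := by
  obtain ⟨k, hk⟩ := h.dvd
  refine Int.modEq_iff_dvd.2 ⟨k, ?_⟩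
  push_cast [pow_succ] at hk ⊢
  rw [← hz]
  linear_combination 9 * hk

/-- Every integer is mod-covered by `Wset n`. -/
lemma exists_cover_Wset (n : ℕ) (z : ℤ) :
    ∃ x ∈ Wset n, ∃ y ∈ Wset n, x ≤ y ∧ 2 * (y : ℤ) - x ≡ z [ZMOD ((9 ^ n : ℕ) : ℤ)] ∧
      (n ≠ 0 → z % 3 = 1 → x < y ∧ y % 3 = 2) := by
  induction n generalizing z with
  | zero => exact ⟨0, by simp [Wset], 0, by simp [Wset], le_rfl, by simp [Int.modEq_one], by simp⟩
  | succ n ih =>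
    have step : ∀ a ∈ ({0, 2, 3, 5} : Finset ℕ), ∀ b ∈ ({0, 2, 3, 5} : Finset ℕ), a ≤ b →
        (z % 3 = 1 → a < b ∧ b % 3 = 2) → (∃ z' : ℤ, 2 * (b : ℤ) - a + 9 * z' = z) →
        ∃ x ∈ Wset (n + 1), ∃ y ∈ Wset (n + 1), x ≤ y ∧
          2 * (y : ℤ) - x ≡ z [ZMOD ((9 ^ (n + 1) : ℕ) : ℤ)] ∧
          (n + 1 ≠ 0 → z % 3 = 1 → x < y ∧ y % 3 = 2) := by
      rintro a ha b hb hab hlt ⟨z', hz'⟩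
      obtain ⟨x, hx, y, hy, hxy, h, -⟩ := ih z'
      exact ⟨_, add_mem_Wset_succ ha hx, _, add_mem_Wset_succ hb hy, by omega,
        modEq_prepend_digit h hz', fun _ h1 => by have := hlt h1; omega⟩
    have hr : z % 9 = 0 ∨ z % 9 = 1 ∨ z % 9 = 2 ∨ z % 9 = 3 ∨ z % 9 = 4 ∨ z % 9 = 5 ∨
      z % 9 = 6 ∨ z % 9 = 7 ∨ z % 9 = 8 := by omega
    rcases hr with h | h | h | h | h | h | h | h | h
    · exact step 0 (by simp) 0 (by simp) (by omega) (by omega) ⟨z / 9, by omega⟩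
    · exact step 0 (by simp) 5 (by simp) (by omega) (by omega) ⟨z / 9 - 1, by omega⟩
    · exact step 2 (by simp) 2 (by simp) (by omega) (by omega) ⟨z / 9, by omega⟩
    · exact step 3 (by simp) 3 (by simp) (by omega) (by omega) ⟨z / 9, by omega⟩
    · exact step 0 (by simp) 2 (by simp) (by omega) (by omega) ⟨z / 9, by omega⟩
    · exact step 5 (by simp) 5 (by simp) (by omega) (by omega) ⟨z / 9, by omega⟩
    · exact step 0 (by simp) 3 (by simp) (by omega) (by omega) ⟨z / 9, by omega⟩
    · exact step 3 (by simp) 5 (by simp) (by omega) (by omega) ⟨z / 9, by omega⟩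
    · exact step 2 (by simp) 5 (by simp) (by omega) (by omega) ⟨z / 9, by omega⟩

lemma mod_three_of_mem_Wset {n w : ℕ} (hw : w ∈ Wset (n + 1)) : w % 3 = 0 ∨ w % 3 = 2 := by
  obtain ⟨d, hd, x, -, rfl⟩ := mem_Wset_succ.1 hw
  simp only [Finset.mem_insert, Finset.mem_singleton] at hd
  omega

lemma emod_three_of_modEq {n : ℕ} {a b : ℤ} (h : a ≡ b [ZMOD ((9 ^ (n + 1) : ℕ) : ℤ)]) :
    a % 3 = b % 3 := by
  refine Int.ModEq.of_dvd ?_ h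
  push_cast
  exact ⟨3 * 9 ^ n, by ring⟩

/-- Residues that are `1` modulo `3` are covered without using `3 ^ (2 * n + 3)`. -/
lemma exists_cover_of_emod_three (n : ℕ) (z : ℤ) (hz : z % 3 = 1) :
    ∃ x ∈ Wset (n + 2), 3 * x ≠ 9 ^ (n + 2) ∧ ∃ y ∈ Wset (n + 2), 3 * y ≠ 9 ^ (n + 2) ∧
      x ≤ y ∧ 2 * (y : ℤ) - x ≡ z [ZMOD ((9 ^ (n + 2) : ℕ) : ℤ)] := by
  induction n generalizing z with
  | zero =>
    have hdec : ∀ r ∈ Finset.range 81, r % 3 = 1 →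
        ∃ x ∈ Wset 2, 3 * x ≠ 81 ∧ ∃ y ∈ Wset 2, 3 * y ≠ 81 ∧ x ≤ y ∧
          (2 * (y : ℤ) - x) % 81 = (r : ℤ) := by decide +kernel
    obtain ⟨x, hx, hx', y, hy, hy', hxy, h⟩ :=
      hdec (z % 81).toNat (by rw [Finset.mem_range]; omega) (by omega)
    refine ⟨x, hx, hx', y, hy, hy', hxy, ?_⟩
    rw [Int.ModEq]
    norm_num
    omega
  | succ n ih =>
    have h9 : 9 ^ (n + 2 + 1) = 9 * 9 ^ (n + 2) := by ring
    have h99 : 9 ^ (n + 2) = 9 * 9 ^ (n + 1) := by ring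
    have hr : z % 9 = 1 ∨ z % 9 = 4 ∨ z % 9 = 7 := by omega
    rw [show n + 1 + 2 = n + 2 + 1 by ring]
    rcases hr with hr | hr | hr
    · obtain ⟨x, hx, y, hy, hxy, h, -⟩ := exists_cover_Wset (n + 2) (z / 9)
      rcases hxy.lt_or_eq with hlt | rfl
      · exact ⟨_, add_mem_Wset_succ (d := 3) (by simp) hx, by omega,
          _, add_mem_Wset_succ (d := 2) (by simp) hy, by omega, by omega,
          modEq_prepend_digit h (by push_cast; omega)⟩
      obtain ⟨u, hu, hu', v, hv, huv, h'⟩ : ∃ u ∈ Wset (n + 2), 3 * u ≠ 9 ^ (n + 2) ∧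
          ∃ v ∈ Wset (n + 2), u ≤ v ∧
            2 * (v : ℤ) - u ≡ z / 9 - 1 [ZMOD ((9 ^ (n + 2) : ℕ) : ℤ)] := by
        obtain ⟨u, hu, v, hv, huv, h', -⟩ := exists_cover_Wset (n + 2) (z / 9 - 1)
        by_cases hu' : 3 * u = 9 ^ (n + 2)
        · have h1 := emod_three_of_modEq h
          have h2 := emod_three_of_modEq h'
          have h3 := mod_three_of_mem_Wset hx
          have h4 := mod_three_of_mem_Wset hv
          obtain ⟨u, hu, hu', v, hv, -, huv, h'⟩ := ih (z / 9 - 1) (by omega)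
          exact ⟨u, hu, hu', v, hv, huv, h'⟩
        · exact ⟨u, hu, hu', v, hv, huv, h'⟩
      exact ⟨_, add_mem_Wset_succ (d := 0) (by simp) hu, by omega,
        _, add_mem_Wset_succ (d := 5) (by simp) hv, by omega, by omega,
        modEq_prepend_digit h' (by push_cast; omega)⟩
    · obtain ⟨x, hx, y, hy, hxy, h, -⟩ := exists_cover_Wset (n + 2) (z / 9)
      exact ⟨_, add_mem_Wset_succ (d := 2) (by simp) hx, by omega,
          _, add_mem_Wset_succ (d := 3) (by simp) hy, by omega, by omega,
          modEq_prepend_digit h (by push_cast; omega)⟩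
    · obtain ⟨x, hx, y, hy, hxy, h, -⟩ := exists_cover_Wset (n + 2) (z / 9)
      exact ⟨_, add_mem_Wset_succ (d := 3) (by simp) hx, by omega,
          _, add_mem_Wset_succ (d := 5) (by simp) hy, by omega, by omega,
          modEq_prepend_digit h (by push_cast; omega)⟩

lemma modCovered_Bset_one (z : ℤ) : ModCovered (9 ^ 1) (Bset 1) z := by
  have hdec : ∀ r ∈ Finset.range 9, ∃ x ∈ Bset 1, ∃ y ∈ Bset 1, x ≤ y ∧
      (2 * (y : ℤ) - x) % 9 = (r : ℤ) := by decide +kernel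
  obtain ⟨x, hx, y, hy, hxy, h⟩ := hdec (z % 9).toNat (by rw [Finset.mem_range]; omega)
  refine ⟨x, hx, y, hy, hxy, ?_⟩
  rw [Int.ModEq]
  norm_num
  omega

lemma modCovered_Bset_two (z : ℤ) : ModCovered (9 ^ 2) (Bset 2) z := by
  have hdec : ∀ r ∈ Finset.range 81, ∃ x ∈ Bset 2, ∃ y ∈ Bset 2, x ≤ y ∧
      (2 * (y : ℤ) - x) % 81 = (r : ℤ) := by decide +kernel
  obtain ⟨x, hx, y, hy, hxy, h⟩ := hdec (z % 81).toNat (by rw [Finset.mem_range]; omega)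
  refine ⟨x, hx, y, hy, hxy, ?_⟩
  rw [Int.ModEq]
  norm_num
  omega

lemma modCovered_Bset_add_two (n : ℕ) (z : ℤ) :
    ModCovered (9 ^ (n + 2)) (Bset (n + 2)) z := by
  induction n generalizing z with
  | zero => exact modCovered_Bset_two z
  | succ n ih =>
    by_cases hz : z % 3 = 1
    · obtain ⟨x, hx, hx', y, hy, hy', hxy, h⟩ := exists_cover_of_emod_three (n + 1) z hz
      exact ⟨x, mem_Bset_succ.2 (Or.inl ⟨hx, hx'⟩), y, mem_Bset_succ.2 (Or.inl ⟨hy, hy'⟩),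
        hxy, h⟩
    have hW : ∀ a ∈ ({2, 3, 5} : Finset ℕ), ∀ x ∈ Wset (n + 2),
        a + 9 * x ∈ Bset (n + 2 + 1) := fun a ha x hx =>
      mem_Bset_succ_succ.2 (Or.inl ⟨a, ha, x, hx, rfl⟩)
    have hB : ∀ x ∈ Bset (n + 2), 0 + 9 * x ∈ Bset (n + 2 + 1) := fun x hx =>
      mem_Bset_succ_succ.2 (Or.inr ⟨x, hx, by ring⟩)
    have step : ∀ a ∈ ({2, 3, 5} : Finset ℕ), ∀ b ∈ ({2, 3, 5} : Finset ℕ), a ≤ b →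
        2 * (b : ℤ) - a + 9 * (z / 9) = z → ModCovered (9 ^ (n + 2 + 1)) (Bset (n + 2 + 1)) z := by
      intro a ha b hb hab hz'
      obtain ⟨x, hx, y, hy, hxy, h, -⟩ := exists_cover_Wset (n + 2) (z / 9)
      exact ⟨_, hW a ha x hx, _, hW b hb y hy, by omega, modEq_prepend_digit h hz'⟩
    rw [show n + 1 + 2 = n + 2 + 1 by ring]
    have hr : z % 9 = 0 ∨ z % 9 = 2 ∨ z % 9 = 3 ∨ z % 9 = 5 ∨ z % 9 = 6 ∨ z % 9 = 8 := by
      omega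
    rcases hr with hr | hr | hr | hr | hr | hr
    · obtain ⟨x, hx, y, hy, hxy, h⟩ := ih (z / 9)
      exact ⟨_, hB x hx, _, hB y hy, by omega, modEq_prepend_digit h (by push_cast; omega)⟩
    · exact step 2 (by simp) 2 (by simp) le_rfl (by push_cast; omega)
    · exact step 3 (by simp) 3 (by simp) le_rfl (by push_cast; omega)
    · exact step 5 (by simp) 5 (by simp) le_rfl (by push_cast; omega)
    · have h9 : 9 ^ (n + 2) = 9 * 9 ^ (n + 1) := by ring
      have lift : ∀ x ∈ Wset (n + 2), 3 * x ≠ 9 ^ (n + 2) → ∀ y ∈ Wset (n + 2), x ≤ y →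
          2 * (y : ℤ) - x ≡ z / 9 [ZMOD ((9 ^ (n + 2) : ℕ) : ℤ)] →
          ModCovered (9 ^ (n + 2 + 1)) (Bset (n + 2 + 1)) z := fun x hx hx' y hy hxy h =>
        ⟨_, hB x (mem_Bset_succ.2 (Or.inl ⟨hx, hx'⟩)), _, hW 3 (by simp) y hy, by omega,
          modEq_prepend_digit h (by push_cast; omega)⟩
      obtain ⟨x, hx, y, hy, hxy, h, -⟩ := exists_cover_Wset (n + 2) (z / 9)
      by_cases hx' : 3 * x = 9 ^ (n + 2)
      · have h1 := emod_three_of_modEq h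
        have h2 := mod_three_of_mem_Wset hy
        by_cases h3 : z / 9 % 3 = 1
        · obtain ⟨u, hu, hu', v, hv, -, huv, h'⟩ := exists_cover_of_emod_three n (z / 9) h3
          exact lift u hu hu' v hv huv h'
        · obtain ⟨u, hu, v, hv, -, h', hlt⟩ := exists_cover_Wset (n + 2) (z / 9 + 1)
          obtain ⟨huv, hv3⟩ := hlt (by omega) (by omega)
          exact ⟨_, hW 3 (by simp) u hu, _,
            hB v (mem_Bset_succ.2 (Or.inl ⟨hv, by omega⟩)), by omega,
            modEq_prepend_digit h' (by push_cast; omega)⟩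
      · exact lift x hx hx' y hy hxy h
    · exact step 2 (by simp) 5 (by simp) (by omega) (by push_cast; omega)

theorem Bset_modular (n : ℕ) (hn : 1 ≤ n) :
    ModularSet (3 ^ (2 * n)) (Bset n) ∧ (Bset n).card = 2 ^ (2 * n) ∧
    ∃ h : (Bset n).Nonempty, (Bset n).max' h = 2 * 3 ^ (2 * n - 1) := by
  obtain ⟨n, rfl⟩ : ∃ m, n = m + 1 := ⟨n - 1, by omega⟩
  have h3 : 3 ^ (2 * (n + 1)) = 9 ^ (n + 1) := by rw [pow_mul]; norm_num
  have h2 : 2 ^ (2 * (n + 1)) = 4 ^ (n + 1) := by rw [pow_mul]; norm_num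
  have hp : 2 * (n + 1) - 1 = 2 * n + 1 := by omega
  have hM := nine_pow_succ_eq n
  have hpos : 0 < 9 ^ (n + 1) := by positivity
  rw [h3, h2, hp]
  refine ⟨⟨⟨zero_mem_Bset n, threeFreeMod_Bset n, fun z => ?_⟩, fun a ha => ?_⟩,
    card_Bset_succ n, ⟨0, zero_mem_Bset n⟩, ?_⟩
  · cases n with
    | zero => exact modCovered_Bset_one z
    | succ n => exact modCovered_Bset_add_two n z
  · have := three_mul_le_of_mem_Bset ha
    omega
  · refine le_antisymm (Finset.max'_le _ _ _ fun a ha => ?_) (Finset.le_max' _ _ ?_)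
    · have := three_mul_le_of_mem_Bset ha
      omega
    · exact mem_Bset_succ.2 (Or.inr (by omega))
end

section
/- For every odd integer λ ≥ 61 with λ ≢ 1 (mod 30), there exists a finite 3-free set A of nonnegative integers such that the Stanley sequence S(A) is independent with character λ. -/
/-- A set of nonnegative integers is 3-free if it contains no 3-term
arithmetic progression. -/
def ThreeFree (S : Set ℕ) : Prop :=
  ∀ x ∈ S, ∀ y ∈ S, ∀ z ∈ S, x < y → y < z → x + z ≠ 2 * y

/-- `a` is the Stanley sequence generated by the finite set `A`:
it is strictly increasing, begins with the elements of `A` in increasing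
order, and thereafter each term is chosen greedily as the least integer
exceeding the previous term which keeps the set of terms 3-free. -/
def IsStanleySeq (A : Finset ℕ) (a : ℕ → ℕ) : Prop :=
  StrictMono a ∧
  (∀ i < A.card, a i ∈ A) ∧
  ∀ k, A.card ≤ k + 1 →
    IsLeast {m : ℕ | a k < m ∧ ThreeFree (a '' Set.Iic k ∪ {m})} (a (k + 1))

/-- The sequence `a` is independent with character `lam`. -/
def IndependentWithChar (a : ℕ → ℕ) (lam : ℤ) : Prop :=
  ∃ κ : ℕ, ∀ k, κ ≤ k →
    (∀ i < 2 ^ k, a (2 ^ k + i) = a (2 ^ k) + a i) ∧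
    (a (2 ^ k) : ℤ) = 2 * (a (2 ^ k - 1) : ℤ) - lam + 1

/-- The ternary expansion of `s` has no digit `2`. -/
def TernaryNoTwo (s : ℕ) : Prop := ∀ i, s / 3 ^ i % 3 ≠ 2

namespace TernaryNoTwo

lemma zero : TernaryNoTwo 0 := fun i => by simp

lemma iff_mod_div (s : ℕ) : TernaryNoTwo s ↔ s % 3 ≠ 2 ∧ TernaryNoTwo (s / 3) := by
  constructor
  · intro h
    refine ⟨by simpa using h 0, fun i => ?_⟩
    have := h (i + 1)
    rwa [pow_succ', ← Nat.div_div_eq_div_mul] at this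
  · rintro ⟨h0, h⟩ i
    cases i with
    | zero => simpa using h0
    | succ i =>
      rw [pow_succ', ← Nat.div_div_eq_div_mul]
      exact h i

lemma three_mul_add {u d : ℕ} (hu : TernaryNoTwo u) (hd : d < 2) : TernaryNoTwo (3 * u + d) := by
  rw [iff_mod_div]
  refine ⟨by omega, ?_⟩
  rwa [show (3 * u + d) / 3 = u by omega]

/-- The integers without ternary digit `2` form a 3-free set. -/
lemma eq_of_add_eq_two_mul (y : ℕ) : ∀ x z, TernaryNoTwo x → TernaryNoTwo y → TernaryNoTwo z →
    x + z = 2 * y → x = y := by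
  induction y using Nat.strong_induction_on with
  | _ y ih =>
    intro x z hx hy hz h
    rcases Nat.eq_zero_or_pos y with rfl | hpos
    · omega
    rw [iff_mod_div] at hx hy hz
    have := ih (y / 3) (by omega) (x / 3) (z / 3) hx.2 hy.2 hz.2 (by omega)
    omega

/-- Every natural number is the last term of a (possibly constant) progression whose first two
terms have no ternary digit `2`. -/
lemma exists_add_eq_two_mul (t : ℕ) :
    ∃ u v, TernaryNoTwo u ∧ TernaryNoTwo v ∧ v ≤ u ∧ t + v = 2 * u := by
  induction t using Nat.strong_induction_on with
  | _ t ih =>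
    rcases Nat.eq_zero_or_pos t with rfl | hpos
    · exact ⟨0, 0, zero, zero, le_rfl, rfl⟩
    obtain ⟨u, v, hu, hv, hle, h⟩ := ih (t / 3) (by omega)
    have hcase : t % 3 = 0 ∨ t % 3 = 1 ∨ t % 3 = 2 := by omega
    rcases hcase with h3 | h3 | h3
    · exact ⟨3 * u + 0, 3 * v + 0, hu.three_mul_add (by omega), hv.three_mul_add (by omega),
        by omega, by omega⟩
    · exact ⟨3 * u + 1, 3 * v + 1, hu.three_mul_add (by omega), hv.three_mul_add (by omega),
        by omega, by omega⟩
    · exact ⟨3 * u + 1, 3 * v + 0, hu.three_mul_add (by omega), hv.three_mul_add (by omega),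
        by omega, by omega⟩

lemma two_mul_add_one_le {s : ℕ} (hs : TernaryNoTwo s) {j : ℕ} (h : s < 3 ^ j) :
    2 * s + 1 ≤ 3 ^ j := by
  induction j generalizing s with
  | zero => simp at h; simp [h]
  | succ j ih =>
    rw [iff_mod_div] at hs
    rw [pow_succ] at h ⊢
    have := ih hs.2 (by omega)
    omega

lemma pow_add_iff {s j : ℕ} (h : s < 3 ^ j) : TernaryNoTwo (3 ^ j + s) ↔ TernaryNoTwo s := by
  induction j generalizing s with
  | zero =>
    obtain rfl : s = 0 := by simpa using h
    exact ⟨fun _ => zero, fun _ => by simpa using zero.three_mul_add (d := 1) (by omega)⟩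
  | succ j ih =>
    rw [pow_succ] at h ⊢
    rw [iff_mod_div, iff_mod_div s, show (3 ^ j * 3 + s) / 3 = 3 ^ j + s / 3 by omega,
      ih (by omega), show (3 ^ j * 3 + s) % 3 = s % 3 by omega]

lemma exists_two_mul_add_one_eq (j : ℕ) : ∃ h, TernaryNoTwo h ∧ 2 * h + 1 = 3 ^ j := by
  induction j with
  | zero => exact ⟨0, zero, rfl⟩
  | succ j ih =>
    obtain ⟨h, hh, e⟩ := ih
    exact ⟨3 * h + 1, hh.three_mul_add (by omega), by rw [pow_succ]; omega⟩

open Classical in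
lemma card_filter_range (j : ℕ) : ((Finset.range (3 ^ j)).filter TernaryNoTwo).card = 2 ^ j := by
  rw [← Nat.count_eq_card_filter_range]
  induction j with
  | zero => rw [pow_zero, pow_zero, ← zero_add 1, Nat.count_succ, Nat.count_zero, if_pos zero]
  | succ j ih =>
    have h1 : Nat.count (fun k => TernaryNoTwo (3 ^ j + k)) (3 ^ j) = 2 ^ j := by
      rw [← ih, Nat.count_eq_card_filter_range, Nat.count_eq_card_filter_range]
      congr 1
      refine Finset.filter_congr fun k hk => pow_add_iff (Finset.mem_range.mp hk)
    have h2 : Nat.count (fun k => TernaryNoTwo (3 ^ j + (3 ^ j + k))) (3 ^ j) = 0 := by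
      rw [Nat.count_eq_card_filter_range, Finset.card_eq_zero, Finset.filter_eq_empty_iff]
      intro k hk hT
      rw [Finset.mem_range] at hk
      have := hT.two_mul_add_one_le (j := j + 1) (by rw [pow_succ]; omega)
      rw [pow_succ] at this
      omega
    rw [show 3 ^ (j + 1) = 3 ^ j + (3 ^ j + 3 ^ j) by ring, Nat.count_add, Nat.count_add, h1, h2, ih]
    ring

end TernaryNoTwo

/-- `A` is a set with least element `0` and greatest element `m` which is 3-free modulo `N` and
such that every residue modulo `N` is the last term of a progression `y ≤ z` from `A`. -/
structure IsModularSet (N m : ℕ) (A : Finset ℕ) : Prop where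
  zero_mem : 0 ∈ A
  max_mem : m ∈ A
  le_max : ∀ x ∈ A, x ≤ m
  free : ∀ x ∈ A, ∀ y ∈ A, ∀ z ∈ A, (x + z) % N = 2 * y % N → x = y ∧ y = z
  cover : ∀ r < N, ∃ y ∈ A, ∃ z ∈ A, y ≤ z ∧ (r + y) % N = 2 * z % N

/-- The set `A + N • S`, where `S` is the set of integers with no ternary digit `2`. -/
def ternaryExtension (N : ℕ) (A : Finset ℕ) (x : ℕ) : Prop :=
  ∃ a ∈ A, ∃ s, TernaryNoTwo s ∧ x = a + N * s

namespace IsModularSet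

variable {N m : ℕ} {A : Finset ℕ}

/-- Raising the greatest element of a modular set by a multiple of the modulus. -/
lemma lift_max (h : IsModularSet N m A) (hm : 0 < m) (k : ℕ) :
    ∃ B : Finset ℕ, B.card = A.card ∧ IsModularSet N (m + N * k) B := by
  set g : ℕ → ℕ := fun x => if x < m then x else x + N * k with hg
  have gmod : ∀ x, g x ≡ x [MOD N] := by
    intro x
    simp only [hg]
    split_ifs
    · rfl
    · simp [Nat.ModEq]
  have gmono : StrictMono g := by
    intro x y hxy
    simp only [hg]
    split_ifs <;> omega
  have g0 : g 0 = 0 := by simp [hg, hm]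
  have gm : g m = m + N * k := by simp [hg]
  refine ⟨A.image g, Finset.card_image_of_injective _ gmono.injective, ?_⟩
  constructor
  · exact Finset.mem_image.mpr ⟨0, h.zero_mem, g0⟩
  · exact Finset.mem_image.mpr ⟨m, h.max_mem, gm⟩
  · intro x hx
    obtain ⟨x, hxA, rfl⟩ := Finset.mem_image.mp hx
    exact gm ▸ gmono.monotone (h.le_max x hxA)
  · intro x hx y hy z hz e
    obtain ⟨x, hxA, rfl⟩ := Finset.mem_image.mp hx
    obtain ⟨y, hyA, rfl⟩ := Finset.mem_image.mp hy
    obtain ⟨z, hzA, rfl⟩ := Finset.mem_image.mp hz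
    have e' : x + z ≡ 2 * y [MOD N] :=
      (((gmod x).add (gmod z)).symm.trans e).trans ((gmod y).mul_left 2)
    obtain ⟨rfl, rfl⟩ := h.free x hxA y hyA z hzA e'
    exact ⟨rfl, rfl⟩
  · intro r hr
    obtain ⟨y, hy, z, hz, hle, e⟩ := h.cover r hr
    refine ⟨g y, Finset.mem_image_of_mem g hy, g z, Finset.mem_image_of_mem g hz,
      gmono.monotone hle, ?_⟩
    exact (((gmod y).add_left r).trans e).trans ((gmod z).mul_left 2).symm

lemma eq_of_mod_eq (h : IsModularSet N m A) {a b : ℕ} (ha : a ∈ A) (hb : b ∈ A)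
    (e : a % N = b % N) : a = b := by
  refine (h.free a ha b hb b hb ?_).1
  rw [two_mul]
  exact Nat.ModEq.add_right b e

lemma threeFree_ternaryExtension (h : IsModularSet N m A) (hN : 0 < N) :
    ThreeFree {x | ternaryExtension N A x} := by
  rintro x ⟨a, ha, s, hs, rfl⟩ y ⟨b, hb, t, ht, rfl⟩ z ⟨c, hc, u, hu, rfl⟩ hxy hyz e
  have e' : (a + c) % N = 2 * b % N := by
    have h1 : (a + N * s + (c + N * u)) % N = (a + c) % N := by
      rw [show a + N * s + (c + N * u) = a + c + N * (s + u) by ring, Nat.add_mul_mod_self_left]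
    have h2 : 2 * (b + N * t) % N = 2 * b % N := by
      rw [show 2 * (b + N * t) = 2 * b + N * (2 * t) by ring, Nat.add_mul_mod_self_left]
    rw [← h1, ← h2, e]
  obtain ⟨rfl, rfl⟩ := h.free a ha b hb c hc e'
  have e2 : s + u = 2 * t := by
    apply Nat.eq_of_mul_eq_mul_left hN
    linarith
  obtain rfl := TernaryNoTwo.eq_of_add_eq_two_mul t s u hs ht hu e2
  exact lt_irrefl _ hxy

lemma exists_progression (h : IsModularSet N m A) (hN : 0 < N) {x : ℕ} (hx : 2 * m ≤ x)
    (hT : ¬ ternaryExtension N A x) :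
    ∃ y z, ternaryExtension N A y ∧ ternaryExtension N A z ∧ y < z ∧ x + y = 2 * z := by
  obtain ⟨y, hy, z, hz, hle, e⟩ := h.cover (x % N) (Nat.mod_lt _ hN)
  have hzm := h.le_max z hz
  have e' : 2 * z ≡ x + y [MOD N] := by
    have : x % N + y ≡ x + y [MOD N] := (Nat.mod_modEq x N).add_right y
    exact Nat.ModEq.trans (Nat.ModEq.symm e) this
  obtain ⟨t, ht⟩ := (Nat.modEq_iff_dvd' (by omega)).mp e'
  obtain ⟨u, v, hu, hv, hvu, huv⟩ := TernaryNoTwo.exists_add_eq_two_mul t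
  have hle' : y + N * v ≤ z + N * u := Nat.add_le_add hle (Nat.mul_le_mul_left N hvu)
  have hN' : N * t + N * v = 2 * (N * u) := by rw [← mul_add, huv]; ring
  have hsum : x + (y + N * v) = 2 * (z + N * u) := by omega
  refine ⟨y + N * v, z + N * u, ⟨y, hy, v, hv, rfl⟩, ⟨z, hz, u, hu, rfl⟩, ?_, hsum⟩
  refine lt_of_le_of_ne hle' fun heq => hT ⟨z, hz, u, hu, by omega⟩

lemma add_mul_le (h : IsModularSet N m A) {a s j : ℕ} (ha : a ∈ A) (hs : TernaryNoTwo s)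
    (hsj : s < 3 ^ j) : 2 * (a + N * s) + N ≤ 2 * m + N * 3 ^ j := by
  have h1 := h.le_max a ha
  have h2 := Nat.mul_le_mul_left N (hs.two_mul_add_one_le hsj)
  linarith

lemma ternaryExtension_iff_of_lt (h : IsModularSet N m A) (hN : 0 < N) {j x : ℕ}
    (hj : 4 * m + N ≤ N * 3 ^ j) :
    x < N * 3 ^ j ∧ ternaryExtension N A x ↔
      ∃ a ∈ A, ∃ s, s < 3 ^ j ∧ TernaryNoTwo s ∧ x = a + N * s := by
  constructor
  · rintro ⟨hx, a, ha, s, hs, rfl⟩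
    refine ⟨a, ha, s, ?_, hs, rfl⟩
    exact Nat.lt_of_mul_lt_mul_left (a := N) (by omega)
  · rintro ⟨a, ha, s, hsj, hs, rfl⟩
    have := h.add_mul_le ha hs hsj
    exact ⟨by omega, a, ha, s, hs, rfl⟩

lemma ternaryExtension_add_iff (h : IsModularSet N m A) (hN : 0 < N) {j x : ℕ}
    (hj : 4 * m + N ≤ N * 3 ^ j) (hx : x < N * 3 ^ j) :
    ternaryExtension N A (N * 3 ^ j + x) ↔ ternaryExtension N A x := by
  constructor
  · rintro ⟨a, ha, s, hs, e⟩
    have h1 : 3 ^ j ≤ s := by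
      by_contra! hlt
      have := h.add_mul_le ha hs hlt
      omega
    have h2 : s < 2 * 3 ^ j := by
      have : N * s < N * (2 * 3 ^ j) := by linarith
      exact Nat.lt_of_mul_lt_mul_left this
    obtain ⟨t, rfl⟩ := Nat.exists_eq_add_of_le h1
    rw [TernaryNoTwo.pow_add_iff (by omega)] at hs
    exact ⟨a, ha, t, hs, by linarith⟩
  · intro hT
    obtain ⟨a, ha, s, hsj, hs, rfl⟩ := (h.ternaryExtension_iff_of_lt hN hj).mp ⟨hx, hT⟩
    exact ⟨a, ha, 3 ^ j + s, (TernaryNoTwo.pow_add_iff hsj).mpr hs, by ring⟩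

open Classical in
lemma count_ternaryExtension (h : IsModularSet N m A) (hN : 0 < N) {j : ℕ}
    (hj : 4 * m + N ≤ N * 3 ^ j) :
    Nat.count (ternaryExtension N A) (N * 3 ^ j) = A.card * 2 ^ j := by
  rw [Nat.count_eq_card_filter_range, ← TernaryNoTwo.card_filter_range, ← Finset.card_product]
  symm
  refine Finset.card_bij (fun p _ => p.1 + N * p.2) ?_ ?_ ?_
  · rintro ⟨a, s⟩ hp
    simp only [Finset.mem_product, Finset.mem_filter, Finset.mem_range] at hp ⊢
    exact (h.ternaryExtension_iff_of_lt hN hj).mpr ⟨a, hp.1, s, hp.2.1, hp.2.2, rfl⟩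
  · rintro ⟨a, s⟩ hp ⟨b, t⟩ hq e
    simp only [Finset.mem_product, Finset.mem_filter, Finset.mem_range] at hp hq e
    have hab : a = b := h.eq_of_mod_eq hp.1 hq.1 (by simpa using congrArg (· % N) e)
    subst hab
    have : s = t := Nat.eq_of_mul_eq_mul_left hN (by omega)
    rw [this]
  · intro x hx
    simp only [Finset.mem_filter, Finset.mem_range] at hx
    obtain ⟨a, ha, s, hsj, hs, rfl⟩ := (h.ternaryExtension_iff_of_lt hN hj).mp hx
    exact ⟨(a, s), by simp [ha, hsj, hs], rfl⟩

lemma infinite_ternaryExtension (h : IsModularSet N m A) (hN : 0 < N) :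
    {x | ternaryExtension N A x}.Infinite := by
  refine Set.infinite_of_not_bddAbove ?_
  rintro ⟨b, hb⟩
  obtain ⟨s, hs, e⟩ := TernaryNoTwo.exists_two_mul_add_one_eq (2 * b + 1)
  have h1 : 0 + N * s ≤ b := hb ⟨0, h.zero_mem, s, hs, rfl⟩
  have h2 : 2 * b + 1 < 3 ^ (2 * b + 1) := Nat.lt_pow_self (by norm_num)
  have h3 : 1 * s ≤ N * s := Nat.mul_le_mul_right s hN
  omega

open Classical in
/-- The last element of the extension below `N * 3 ^ j`. -/
lemma nth_last (h : IsModularSet N m A) (hN : 0 < N) {j : ℕ}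
    (hj : 4 * m + N ≤ N * 3 ^ j) :
    2 * Nat.nth (ternaryExtension N A) (A.card * 2 ^ j - 1) + N = 2 * m + N * 3 ^ j := by
  obtain ⟨s, hs, e⟩ := TernaryNoTwo.exists_two_mul_add_one_eq j
  have hM : ternaryExtension N A (m + N * s) := ⟨m, h.max_mem, s, hs, rfl⟩
  have hNs : 2 * (N * s) + N = N * 3 ^ j := by rw [← e]; ring
  have hlt : m + N * s + 1 ≤ N * 3 ^ j := by omega
  have hcount : Nat.count (ternaryExtension N A) (m + N * s + 1) = A.card * 2 ^ j := by
    rw [← h.count_ternaryExtension hN hj, Nat.count_eq_card_filter_range,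
      Nat.count_eq_card_filter_range]
    congr 1
    ext x
    simp only [Finset.mem_filter, Finset.mem_range]
    constructor
    · rintro ⟨hx, hT⟩
      exact ⟨by omega, hT⟩
    · intro hx
      obtain ⟨a, ha, t, htj, ht, rfl⟩ := (h.ternaryExtension_iff_of_lt hN hj).mp hx
      have := h.add_mul_le ha ht htj
      exact ⟨by omega, hx.2⟩
  rw [Nat.count_succ, if_pos hM] at hcount
  rw [← hcount, Nat.add_sub_cancel, Nat.nth_count hM]
  omega

open Classical in
/-- A modular set whose cardinality is a power of two generates an independent Stanley
sequence. -/
theorem exists_independent (h : IsModularSet N m A) (hN : 0 < N) {e : ℕ} (hcard : A.card = 2 ^ e) :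
    ∃ B : Finset ℕ, B.Nonempty ∧ ThreeFree ↑B ∧
      ∃ a : ℕ → ℕ, IsStanleySeq B a ∧ IndependentWithChar a (2 * m + 1 - N) := by
  set T := ternaryExtension N A
  have hinf : {x | T x}.Infinite := h.infinite_ternaryExtension hN
  have hfree : ThreeFree {x | T x} := h.threeFree_ternaryExtension hN
  have hlarge : ∀ j, 4 * m + 1 ≤ j → 4 * m + N ≤ N * 3 ^ j := by
    intro j hj
    have h1 : j < 3 ^ j := Nat.lt_pow_self (by norm_num)
    have h2 : N * (4 * m + 1) ≤ N * 3 ^ j := Nat.mul_le_mul_left N (by omega)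
    nlinarith
  set J := 4 * m + 1
  have hJ' := hlarge J le_rfl
  set B := (Finset.range (N * 3 ^ J)).filter T with hB
  have hBcard : B.card = A.card * 2 ^ J := by
    rw [hB, ← Nat.count_eq_card_filter_range]
    exact h.count_ternaryExtension hN hJ'
  have hmono : StrictMono (Nat.nth T) := Nat.nth_strictMono hinf
  have hmem : ∀ i, T (Nat.nth T i) := Nat.nth_mem_of_infinite hinf
  refine ⟨B, ?_, ?_, Nat.nth T, ⟨hmono, ?_, ?_⟩, J + e, ?_⟩
  · rw [← Finset.card_pos, hBcard, hcard]
    positivity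
  · intro x hx y hy z hz
    exact hfree x (Finset.mem_filter.mp hx).2 y (Finset.mem_filter.mp hy).2 z
      (Finset.mem_filter.mp hz).2
  · intro i hi
    rw [hB, ← Nat.count_eq_card_filter_range] at hi
    exact Finset.mem_filter.mpr ⟨Finset.mem_range.mpr (Nat.nth_lt_of_lt_count hi), hmem i⟩
  · intro k hk
    refine ⟨⟨hmono k.lt_succ_self, ?_⟩, ?_⟩
    · have hsub : ∀ x ∈ Nat.nth T '' Set.Iic k ∪ {Nat.nth T (k + 1)}, T x := by
        rintro x (⟨i, -, rfl⟩ | rfl)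
        · exact hmem i
        · exact hmem _
      exact fun x hx y hy z hz => hfree x (hsub x hx) y (hsub y hy) z (hsub z hz)
    · rintro x ⟨hkx, hx⟩
      by_contra! hlt
      have hmem_image : ∀ z, T z → z < x → z ∈ Nat.nth T '' Set.Iic k := by
        intro z hz hzx
        refine ⟨Nat.count T z, ?_, Nat.nth_count hz⟩
        have : Nat.nth T (Nat.count T z) < Nat.nth T (k + 1) := by
          rw [Nat.nth_count hz]
          omega
        exact Nat.lt_succ_iff.mp (hmono.lt_iff_lt.mp this)
      have hxT : ¬ T x := by
        intro hT
        rw [← Nat.nth_count hT] at hkx hlt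
        have h1 := hmono.lt_iff_lt.mp hkx
        have h2 := hmono.lt_iff_lt.mp hlt
        omega
      have hlast : 2 * Nat.nth T (A.card * 2 ^ J - 1) + N = 2 * m + N * 3 ^ J :=
        h.nth_last hN hJ'
      have hle : Nat.nth T (A.card * 2 ^ J - 1) ≤ Nat.nth T k := hmono.monotone (by omega)
      obtain ⟨y, z, hy, hz, hyz, hsum⟩ := h.exists_progression hN (x := x) (by omega) hxT
      exact hx y (Or.inl (hmem_image y hy (by omega))) z (Or.inl (hmem_image z hz (by omega))) x
        (Or.inr rfl) hyz (by omega) (by omega)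
  · intro k hk
    obtain ⟨j, rfl⟩ := Nat.exists_eq_add_of_le (show e ≤ k by omega)
    have hj := hlarge j (by omega)
    have hpow : 2 ^ (e + j) = A.card * 2 ^ j := by rw [pow_add, hcard]
    have hcount : Nat.count T (N * 3 ^ j) = 2 ^ (e + j) := by
      rw [hpow]
      exact h.count_ternaryExtension hN hj
    have hshift : ∀ i < 2 ^ (e + j), Nat.nth T (2 ^ (e + j) + i) = N * 3 ^ j + Nat.nth T i := by
      intro i hi
      have hlt : Nat.nth T i < N * 3 ^ j := Nat.nth_lt_of_lt_count (hcount ▸ hi)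
      have hT : T (N * 3 ^ j + Nat.nth T i) :=
        (h.ternaryExtension_add_iff hN hj hlt).mpr (hmem i)
      have hc : Nat.count T (N * 3 ^ j + Nat.nth T i) = 2 ^ (e + j) + i := by
        rw [Nat.count_add, hcount]
        congr 1
        conv_rhs => rw [← Nat.count_nth_of_infinite hinf i]
        rw [Nat.count_eq_card_filter_range, Nat.count_eq_card_filter_range]
        congr 1
        refine Finset.filter_congr fun x hx => ?_
        exact h.ternaryExtension_add_iff hN hj ((Finset.mem_range.mp hx).trans hlt)
      rw [← hc, Nat.nth_count hT]
    have hzero : Nat.nth T 0 = 0 :=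
      Nat.nth_zero_of_zero ⟨0, h.zero_mem, 0, TernaryNoTwo.zero, rfl⟩
    have hstart : Nat.nth T (2 ^ (e + j)) = N * 3 ^ j := by
      simpa [hzero] using hshift 0 (by positivity)
    refine ⟨fun i hi => by rw [hshift i hi, hstart], ?_⟩
    have hlast : 2 * Nat.nth T (2 ^ (e + j) - 1) + N = 2 * m + N * 3 ^ j :=
      hpow ▸ h.nth_last hN hj
    rw [hstart]
    zify at hlast
    push_cast
    linarith

end IsModularSet

lemma exists_isModularSet_thirty (c : ℕ) (h1 : 46 ≤ c) (h2 : c ≤ 74) (h3 : c ≠ 60) :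
    ∃ A : Finset ℕ, A.card = 8 ∧ IsModularSet 30 c A := by
  interval_cases c
  · exact ⟨{0, 4, 9, 13, 33, 37, 42, 46}, by decide, by constructor <;> decide +kernel⟩
  · exact ⟨{0, 1, 7, 8, 10, 11, 18, 47}, by decide, by constructor <;> decide +kernel⟩
  · exact ⟨{0, 10, 13, 21, 27, 31, 34, 48}, by decide, by constructor <;> decide +kernel⟩
  · exact ⟨{0, 1, 21, 22, 27, 28, 48, 49}, by decide, by constructor <;> decide +kernel⟩
  · exact ⟨{0, 1, 4, 24, 33, 41, 43, 50}, by decide, by constructor <;> decide +kernel⟩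
  · exact ⟨{0, 1, 3, 4, 10, 13, 14, 51}, by decide, by constructor <;> decide +kernel⟩
  · exact ⟨{0, 3, 4, 21, 24, 25, 31, 52}, by decide, by constructor <;> decide +kernel⟩
  · exact ⟨{0, 1, 3, 4, 11, 14, 20, 53}, by decide, by constructor <;> decide +kernel⟩
  · exact ⟨{0, 3, 10, 13, 21, 31, 34, 54}, by decide, by constructor <;> decide +kernel⟩
  · exact ⟨{0, 1, 3, 4, 21, 22, 24, 55}, by decide, by constructor <;> decide +kernel⟩
  · exact ⟨{0, 2, 3, 5, 21, 23, 24, 56}, by decide, by constructor <;> decide +kernel⟩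
  · exact ⟨{0, 1, 10, 11, 37, 38, 48, 57}, by decide, by constructor <;> decide +kernel⟩
  · exact ⟨{0, 3, 10, 21, 24, 31, 37, 58}, by decide, by constructor <;> decide +kernel⟩
  · exact ⟨{0, 3, 11, 21, 24, 32, 38, 59}, by decide, by constructor <;> decide +kernel⟩
  · exact absurd rfl h3
  · exact ⟨{0, 9, 13, 33, 34, 40, 42, 61}, by decide, by constructor <;> decide +kernel⟩
  · exact ⟨{0, 3, 14, 21, 24, 35, 41, 62}, by decide, by constructor <;> decide +kernel⟩
  · exact ⟨{0, 23, 31, 34, 40, 41, 44, 63}, by decide, by constructor <;> decide +kernel⟩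
  · exact ⟨{0, 9, 10, 13, 31, 33, 42, 64}, by decide, by constructor <;> decide +kernel⟩
  · exact ⟨{0, 9, 11, 33, 42, 44, 62, 65}, by decide, by constructor <;> decide +kernel⟩
  · exact ⟨{0, 10, 27, 39, 43, 61, 64, 66}, by decide, by constructor <;> decide +kernel⟩
  · exact ⟨{0, 1, 3, 21, 28, 40, 54, 67}, by decide, by constructor <;> decide +kernel⟩
  · exact ⟨{0, 1, 7, 10, 11, 17, 18, 68}, by decide, by constructor <;> decide +kernel⟩
  · exact ⟨{0, 22, 23, 29, 33, 40, 62, 69}, by decide, by constructor <;> decide +kernel⟩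
  · exact ⟨{0, 3, 11, 14, 31, 34, 43, 70}, by decide, by constructor <;> decide +kernel⟩
  · exact ⟨{0, 3, 10, 13, 31, 34, 44, 71}, by decide, by constructor <;> decide +kernel⟩
  · exact ⟨{0, 9, 10, 13, 31, 33, 34, 72}, by decide, by constructor <;> decide +kernel⟩
  · exact ⟨{0, 1, 9, 10, 33, 34, 42, 73}, by decide, by constructor <;> decide +kernel⟩
  · exact ⟨{0, 3, 10, 13, 31, 34, 41, 74}, by decide, by constructor <;> decide +kernel⟩

theorem characters_not_one_mod_thirty (lam : ℕ) (hodd : Odd lam) (hge : 61 ≤ lam)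
    (hmod : lam % 30 ≠ 1) :
    ∃ A : Finset ℕ, A.Nonempty ∧ ThreeFree ↑A ∧
      ∃ a : ℕ → ℕ, IsStanleySeq A a ∧ IndependentWithChar a (lam : ℤ) := by
  obtain ⟨q, hq⟩ := hodd
  obtain ⟨c, k, hc1, hc2, hc3, hck⟩ : ∃ c k, 46 ≤ c ∧ c ≤ 74 ∧ c ≠ 60 ∧ q + 15 = c + 30 * k :=
    ⟨46 + (q + 15 - 46) % 30, (q + 15 - 46) / 30, by omega, by omega, by omega, by omega⟩
  obtain ⟨A₀, hcard₀, hA₀⟩ := exists_isModularSet_thirty c hc1 hc2 hc3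
  obtain ⟨A, hcard, hA⟩ := hA₀.lift_max (by omega) k
  obtain ⟨B, hne, hfree, a, ha, hchar⟩ :=
    hA.exists_independent (by norm_num) (e := 3) (by rw [hcard, hcard₀]; norm_num)
  refine ⟨B, hne, hfree, a, ha, ?_⟩
  convert hchar using 1
  push_cast
  omega
end

section
/- Let λ > 1 be an integer with λ ≡ 1 (mod 30) such that λ ≠ 10·3^n + 1 and λ ≠ 20·3^n + 1 for every positive integer n. Then there exists a finite 3-free set A of nonnegative integers such that the Stanley sequence S(A) is independent with character λ. -/
/-- The number whose ternary digits are the binary digits of `q`. -/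
def ternaryOfBinary (q : ℕ) : ℕ := Nat.ofDigits 3 (Nat.digits 2 q)

namespace ternaryOfBinary

@[simp] lemma zero : ternaryOfBinary 0 = 0 := by simp [ternaryOfBinary]

lemma two_mul (q : ℕ) : ternaryOfBinary (2 * q) = 3 * ternaryOfBinary q := by
  rcases Nat.eq_zero_or_pos q with rfl | hq
  · simp
  · have h : Nat.digits 2 (2 * q) = 0 :: Nat.digits 2 q := by
      simpa using Nat.digits_add 2 one_lt_two 0 q (by norm_num) (Or.inr hq.ne')
    simp [ternaryOfBinary, h, Nat.ofDigits_cons]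

lemma two_mul_add_one (q : ℕ) :
    ternaryOfBinary (2 * q + 1) = 3 * ternaryOfBinary q + 1 := by
  have h : Nat.digits 2 (2 * q + 1) = 1 :: Nat.digits 2 q := by
    simpa [add_comm] using Nat.digits_add 2 one_lt_two 1 q (by norm_num) (Or.inl one_ne_zero)
  rw [ternaryOfBinary, h, Nat.ofDigits_cons, ternaryOfBinary]
  ring

lemma one : ternaryOfBinary 1 = 1 := by simpa using two_mul_add_one 0

lemma two_pow_add (l : ℕ) : ∀ q < 2 ^ l,
    ternaryOfBinary (2 ^ l + q) = 3 ^ l + ternaryOfBinary q := by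
  induction l with
  | zero => intro q hq; obtain rfl : q = 0 := by omega
            simp [one]
  | succ l ih =>
    intro q hq
    rw [pow_succ] at hq
    rcases Nat.even_or_odd' q with ⟨r, rfl | rfl⟩
    · rw [show 2 ^ (l + 1) + 2 * r = 2 * (2 ^ l + r) by ring, two_mul, two_mul,
        ih r (by omega)]
      ring
    · rw [show 2 ^ (l + 1) + (2 * r + 1) = 2 * (2 ^ l + r) + 1 by ring, two_mul_add_one,
        two_mul_add_one, ih r (by omega)]
      ring

lemma two_pow (l : ℕ) : ternaryOfBinary (2 ^ l) = 3 ^ l := by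
  simpa using two_pow_add l 0 (by positivity)

lemma two_pow_sub_one (l : ℕ) : 2 * ternaryOfBinary (2 ^ l - 1) + 1 = 3 ^ l := by
  induction l with
  | zero => simp
  | succ l ih =>
    have h : 2 ^ (l + 1) - 1 = 2 * (2 ^ l - 1) + 1 := by
      have := Nat.one_le_two_pow (n := l)
      rw [pow_succ]; omega
    rw [h, two_mul_add_one, pow_succ, ← ih]
    ring

lemma strictMono : StrictMono ternaryOfBinary := by
  refine strictMono_nat_of_lt_succ fun n => ?_
  induction n using Nat.strong_induction_on with
  | _ n ih =>
    rcases Nat.even_or_odd' n with ⟨r, rfl | rfl⟩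
    · rw [two_mul, two_mul_add_one]; omega
    · rw [show 2 * r + 1 + 1 = 2 * (r + 1) by ring, two_mul, two_mul_add_one]
      have := ih r (by omega)
      omega

lemma eq_of_add_eq_two_mul (x : ℕ) : ∀ y z,
    ternaryOfBinary x + ternaryOfBinary z = 2 * ternaryOfBinary y → x = z := by
  induction x using Nat.strong_induction_on with
  | _ x ih =>
    intro y z h
    rcases Nat.eq_zero_or_pos x with rfl | hx
    · by_contra hz
      induction z using Nat.strong_induction_on generalizing y with
      | _ z ihz =>
        rcases Nat.even_or_odd' y with ⟨y, rfl | rfl⟩ <;>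
        rcases Nat.even_or_odd' z with ⟨z, rfl | rfl⟩ <;>
        simp only [two_mul, two_mul_add_one, zero] at h ihz
        · exact ihz z (by omega) y (by omega) (by omega)
        all_goals omega
    · rcases Nat.even_or_odd' x with ⟨x, rfl | rfl⟩ <;>
      rcases Nat.even_or_odd' y with ⟨y, rfl | rfl⟩ <;>
      rcases Nat.even_or_odd' z with ⟨z, rfl | rfl⟩ <;>
      simp only [two_mul, two_mul_add_one] at h <;>
      first
        | omega
        | (have := ih x (by omega) y z (by omega); omega)

lemma exists_two_mul_eq_add (v : ℕ) :
    ∃ s t, t ≤ s ∧ 2 * ternaryOfBinary s = ternaryOfBinary t + v := by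
  induction v using Nat.strong_induction_on with
  | _ v ih =>
    rcases Nat.eq_zero_or_pos v with rfl | hv
    · exact ⟨0, 0, le_rfl, by simp⟩
    · obtain ⟨s, t, hst, h⟩ := ih (v / 3) (by omega)
      have h3 : v % 3 = 0 ∨ v % 3 = 1 ∨ v % 3 = 2 := by omega
      rcases h3 with h3 | h3 | h3
      · exact ⟨2 * s, 2 * t, by omega, by rw [two_mul, two_mul]; omega⟩
      · exact ⟨2 * s + 1, 2 * t + 1, by omega, by
          rw [two_mul_add_one, two_mul_add_one]; omega⟩
      · exact ⟨2 * s + 1, 2 * t, by omega, by rw [two_mul_add_one, two_mul]; omega⟩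

end ternaryOfBinary

/-- A finite set of integers is modular modulo `N` if it contains no nontrivial three-term
progression modulo `N` and every residue has the form `2 * s - t` with `t ≤ s` in the set. -/
structure IsModular (N : ℤ) (A : Finset ℤ) : Prop where
  free : ∀ x ∈ A, ∀ y ∈ A, ∀ z ∈ A, N ∣ x + z - 2 * y → x = y ∧ y = z
  cover : ∀ u : ℤ, ∃ s ∈ A, ∃ t ∈ A, t ≤ s ∧ N ∣ 2 * s - t - u

/-- The set of all `w + L * g` with `w ∈ W` and `g ∈ H w`. -/
def fiberedSum (L : ℤ) (W : Finset ℤ) (H : ℤ → Finset ℤ) : Finset ℤ :=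
  (W.sigma H).image fun p => p.1 + L * p.2

lemma mem_fiberedSum {L : ℤ} {W : Finset ℤ} {H : ℤ → Finset ℤ} {x : ℤ} :
    x ∈ fiberedSum L W H ↔ ∃ w ∈ W, ∃ g ∈ H w, w + L * g = x := by
  simp [fiberedSum, and_assoc]

section fiberedSum

variable {L K : ℤ} {W : Finset ℤ} {H : ℤ → Finset ℤ}

lemma fiberedSum_free (hL : L ≠ 0)
    (hW : ∀ x ∈ W, ∀ y ∈ W, ∀ z ∈ W, L ∣ x + z - 2 * y → x = y ∧ y = z)
    (hH : ∀ w ∈ W, ∀ x ∈ H w, ∀ y ∈ H w, ∀ z ∈ H w, K ∣ x + z - 2 * y → x = y ∧ y = z) :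
    ∀ x ∈ fiberedSum L W H, ∀ y ∈ fiberedSum L W H, ∀ z ∈ fiberedSum L W H,
      L * K ∣ x + z - 2 * y → x = y ∧ y = z := by
  intro x hx y hy z hz h
  obtain ⟨w₁, hw₁, g₁, hg₁, rfl⟩ := mem_fiberedSum.1 hx
  obtain ⟨w₂, hw₂, g₂, hg₂, rfl⟩ := mem_fiberedSum.1 hy
  obtain ⟨w₃, hw₃, g₃, hg₃, rfl⟩ := mem_fiberedSum.1 hz
  obtain ⟨rfl, rfl⟩ := hW w₁ hw₁ w₂ hw₂ w₃ hw₃ (by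
    obtain ⟨c, hc⟩ := h
    exact ⟨K * c - g₁ - g₃ + 2 * g₂, by linear_combination hc⟩)
  obtain ⟨rfl, rfl⟩ := hH w₁ hw₁ g₁ hg₁ g₂ hg₂ g₃ hg₃ (by
    obtain ⟨c, hc⟩ := h
    exact ⟨c, mul_left_cancel₀ hL (by linear_combination hc)⟩)
  simp

lemma card_fiberedSum (hL : L ≠ 0)
    (hW : ∀ x ∈ W, ∀ y ∈ W, ∀ z ∈ W, L ∣ x + z - 2 * y → x = y ∧ y = z) {n : ℕ}
    (hH : ∀ w ∈ W, (H w).card = n) : (fiberedSum L W H).card = W.card * n := by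
  rw [fiberedSum, Finset.card_image_of_injOn, Finset.card_sigma, Finset.sum_congr rfl hH,
    Finset.sum_const, smul_eq_mul]
  rintro ⟨w, g⟩ h ⟨w', g'⟩ h' heq
  simp only [Finset.coe_sigma, Set.mem_sigma_iff, Finset.mem_coe] at h h' heq
  have hw : w = w' := (hW w h.1 w h.1 w' h'.1 ⟨g - g', by linear_combination -heq⟩).2
  subst hw
  simpa [hL] using heq

end fiberedSum

lemma IsModular.mul {L K : ℤ} {W F : Finset ℤ} (hL : 0 < L) (hW : IsModular L W)
    (hF : IsModular K F) : IsModular (L * K) (fiberedSum L W fun _ => F) where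
  free := fiberedSum_free hL.ne' hW.free fun _ _ => hF.free
  cover u := by
    obtain ⟨s, hs, t, ht, hst, e, he⟩ := hW.cover u
    obtain ⟨g, hg, a, ha, hag, c, hc⟩ := hF.cover (-e)
    refine ⟨_, mem_fiberedSum.2 ⟨s, hs, g, hg, rfl⟩, _, mem_fiberedSum.2 ⟨t, ht, a, ha, rfl⟩,
      ?_, c, ?_⟩
    · gcongr
    · linear_combination he + L * hc

/-- The integers with at most `n` ternary digits, all of them `0` or `1`. -/
def binaryDigitSet : ℕ → Finset ℤ
  | 0 => {0}
  | n + 1 => fiberedSum 3 {0, 1} fun _ => binaryDigitSet n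

lemma IsModular.of_residues {N : ℕ} (hN : 0 < N) {A : Finset ℤ}
    (free : ∀ x ∈ A, ∀ y ∈ A, ∀ z ∈ A, (N : ℤ) ∣ x + z - 2 * y → x = y ∧ y = z)
    (cover : ∀ r ∈ Finset.range N, ∃ s ∈ A, ∃ t ∈ A, t ≤ s ∧ (N : ℤ) ∣ 2 * s - t - r) :
    IsModular N A where
  free := free
  cover u := by
    have hN' : (0 : ℤ) < N := by exact_mod_cast hN
    have h0 := Int.emod_nonneg u hN'.ne'
    have h1 := Int.emod_lt_of_pos u hN'
    obtain ⟨s, hs, t, ht, hst, c, hc⟩ := cover (u % N).toNat (by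
      rw [Finset.mem_range]; omega)
    rw [Int.toNat_of_nonneg h0] at hc
    refine ⟨s, hs, t, ht, hst, c - u / N, ?_⟩
    linear_combination hc + Int.emod_add_mul_ediv u N

lemma isModular_zero_one : IsModular 3 {0, 1} :=
  IsModular.of_residues (N := 3) (by norm_num) (by decide) (by decide)

lemma isModular_ten : IsModular 10 {0, 1, 7, 8} :=
  IsModular.of_residues (N := 10) (by norm_num) (by decide) (by decide)

namespace binaryDigitSet

lemma isModular (n : ℕ) : IsModular (3 ^ n) (binaryDigitSet n) := by
  induction n with
  | zero => exact ⟨by simp [binaryDigitSet], by simp [binaryDigitSet]⟩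
  | succ n ih =>
    rw [pow_succ', binaryDigitSet]
    exact isModular_zero_one.mul (by norm_num) ih

lemma card (n : ℕ) : (binaryDigitSet n).card = 2 ^ n := by
  induction n with
  | zero => rfl
  | succ n ih =>
    rw [binaryDigitSet, card_fiberedSum (by norm_num) isModular_zero_one.free fun _ _ => ih,
      pow_succ']
    rfl

lemma mem_succ {n : ℕ} {x : ℤ} : x ∈ binaryDigitSet (n + 1) ↔
    ∃ r ∈ binaryDigitSet n, x = 3 * r ∨ x = 3 * r + 1 := by
  rw [binaryDigitSet, mem_fiberedSum]
  constructor
  · rintro ⟨d, hd, r, hr, rfl⟩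
    simp only [Finset.mem_insert, Finset.mem_singleton] at hd
    exact ⟨r, hr, by omega⟩
  · rintro ⟨r, hr, rfl | rfl⟩
    · exact ⟨0, by simp, r, hr, by ring⟩
    · exact ⟨1, by simp, r, hr, by ring⟩

lemma zero_mem (n : ℕ) : 0 ∈ binaryDigitSet n := by
  induction n with
  | zero => simp [binaryDigitSet]
  | succ n ih => exact mem_succ.2 ⟨0, ih, by simp⟩

lemma nonneg {n : ℕ} : ∀ {x : ℤ}, x ∈ binaryDigitSet n → 0 ≤ x := by
  induction n with
  | zero => simp [binaryDigitSet]
  | succ n ih =>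
    intro x hx
    obtain ⟨r, hr, h⟩ := mem_succ.1 hx
    have := ih hr
    omega

lemma two_mul_add_one_le {n : ℕ} : ∀ {x : ℤ}, x ∈ binaryDigitSet n → 2 * x + 1 ≤ 3 ^ n := by
  induction n with
  | zero => simp [binaryDigitSet]
  | succ n ih =>
    intro x hx
    obtain ⟨r, hr, h⟩ := mem_succ.1 hx
    have := ih hr
    rw [pow_succ]
    omega

lemma exists_max (n : ℕ) : ∃ x ∈ binaryDigitSet n, 2 * x + 1 = 3 ^ n := by
  induction n with
  | zero => exact ⟨0, by simp [binaryDigitSet], by simp⟩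
  | succ n ih =>
    obtain ⟨r, hr, h⟩ := ih
    exact ⟨3 * r + 1, mem_succ.2 ⟨r, hr, by simp⟩, by rw [pow_succ]; omega⟩

lemma exists_alternative {n : ℕ} : ∀ {s : ℤ}, s ∈ binaryDigitSet n → s ≠ 0 →
    ∃ s' ∈ binaryDigitSet n, ∃ t' ∈ binaryDigitSet n, t' ≠ 0 ∧
      (2 * s' - t' = 2 * s ∨ 2 * s' - t' = 2 * s - 3 ^ n) := by
  induction n with
  | zero => simp [binaryDigitSet]
  | succ n ih =>
    intro s hs hs0
    obtain ⟨r, hr, h⟩ := mem_succ.1 hs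
    by_cases hr0 : r = 0
    · obtain rfl : s = 1 := by omega
      cases n with
      | zero =>
        exact ⟨0, zero_mem _, 1, mem_succ.2 ⟨0, zero_mem _, by simp⟩, by norm_num, by norm_num⟩
      | succ n =>
        have h1 : (1 : ℤ) ∈ binaryDigitSet (n + 1) := mem_succ.2 ⟨0, zero_mem _, by simp⟩
        exact ⟨3, mem_succ.2 ⟨1, h1, by simp⟩, 4, mem_succ.2 ⟨1, h1, by simp⟩, by norm_num,
          by norm_num⟩
    · obtain ⟨r', hr', q', hq', hq0, heq⟩ := ih hr hr0
      rw [pow_succ]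
      rcases h with rfl | rfl
      · exact ⟨3 * r', mem_succ.2 ⟨r', hr', by simp⟩, 3 * q', mem_succ.2 ⟨q', hq', by simp⟩,
          by omega, by omega⟩
      · exact ⟨3 * r' + 1, mem_succ.2 ⟨r', hr', by simp⟩, 3 * q',
          mem_succ.2 ⟨q', hq', by simp⟩, by omega, by omega⟩

end binaryDigitSet

/-- The fibre `G₀` may replace the fibre `G` over `0`: residues missed by combining the two are
attained, as are their successors, by pairs that remain ordered after a change of base point. -/
def IsCompatible (K : ℤ) (G₀ G : Finset ℤ) : Prop :=
  ∀ e : ℤ, (∃ g ∈ G, ∃ a ∈ G₀, a ≤ g ∧ K ∣ 2 * g - a - e) ∨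
    (∃ g ∈ G, ∃ a ∈ G, a < g ∧ K ∣ 2 * g - a - e) ∧
    (∃ g ∈ G, ∃ a ∈ G, a < g ∧ K ∣ 2 * g - a - (e + 1)) ∧
    (∃ g ∈ G₀, ∃ a ∈ G, a < g ∧ K ∣ 2 * g - a - (e + 1))

/-- A digit set stays modular when its fibre over `0` is replaced by a compatible one. -/
lemma isModular_fiberedSum_ite {K : ℤ} {G₀ G : Finset ℤ} (n : ℕ) (h₀ : IsModular K G₀)
    (h : IsModular K G)
    (hmix : IsCompatible K G₀ G) :
    IsModular (3 ^ n * K)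
      (fiberedSum (3 ^ n) (binaryDigitSet n) fun w => if w = 0 then G₀ else G) where
  free := by
    refine fiberedSum_free (by positivity) (binaryDigitSet.isModular n).free fun w _ => ?_
    split_ifs
    exacts [h₀.free, h.free]
  cover u := by
    have hpos : (0 : ℤ) < 3 ^ n := by positivity
    have key : ∀ s ∈ binaryDigitSet n, ∀ t ∈ binaryDigitSet n, ∀ e,
        2 * s - t + 3 ^ n * e = u →
        (∃ g ∈ (if s = 0 then G₀ else G), ∃ a ∈ (if t = 0 then G₀ else G),
          (t ≤ s ∧ a ≤ g ∨ a < g) ∧ K ∣ 2 * g - a - e) →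
        ∃ x ∈ fiberedSum (3 ^ n) (binaryDigitSet n) (fun w => if w = 0 then G₀ else G),
        ∃ y ∈ fiberedSum (3 ^ n) (binaryDigitSet n) (fun w => if w = 0 then G₀ else G),
          y ≤ x ∧ 3 ^ n * K ∣ 2 * x - y - u := by
      rintro s hs t ht e rfl ⟨g, hg, a, ha, hle, c, hc⟩
      refine ⟨_, mem_fiberedSum.2 ⟨s, hs, g, hg, rfl⟩, _,
        mem_fiberedSum.2 ⟨t, ht, a, ha, rfl⟩, ?_, c, by linear_combination 3 ^ n * hc⟩
      rcases hle with ⟨h1, h2⟩ | h2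
      · gcongr
      · have := binaryDigitSet.nonneg hs
        have := binaryDigitSet.nonneg ht
        have := binaryDigitSet.two_mul_add_one_le ht
        nlinarith
    obtain ⟨s, hs, t, ht, hst, c, hc⟩ := (binaryDigitSet.isModular n).cover u
    have hu : 2 * s - t + 3 ^ n * (-c) = u := by linear_combination hc
    have hs0 := binaryDigitSet.nonneg hs
    have ht0 := binaryDigitSet.nonneg ht
    generalize -c = e at hu
    by_cases hsz : s = 0
    · obtain ⟨g, hg, a, ha, hag, hd⟩ := h₀.cover e
      refine key s hs t ht e hu ⟨g, ?_, a, ?_, Or.inl ⟨hst, hag⟩, hd⟩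
      · rwa [if_pos hsz]
      · rwa [if_pos (by omega)]
    by_cases htz : t = 0
    · rcases hmix e with ⟨g, hg, a, ha, hag, hd⟩ | ⟨hG, hG', hG₀⟩
      · refine key s hs t ht e hu ⟨g, ?_, a, ?_, Or.inl ⟨hst, hag⟩, hd⟩
        · rwa [if_neg hsz]
        · rwa [if_pos htz]
      · obtain ⟨s', hs', t', ht', htz', heq⟩ := binaryDigitSet.exists_alternative hs hsz
        have hs0' := binaryDigitSet.nonneg hs'
        have ht0' := binaryDigitSet.nonneg ht'
        rcases heq with heq | heq
        · obtain ⟨g, hg, a, ha, hag, hd⟩ := hG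
          refine key s' hs' t' ht' e (by linear_combination heq + hu + htz)
            ⟨g, ?_, a, ?_, Or.inr hag, hd⟩
          · rwa [if_neg (by omega)]
          · rwa [if_neg htz']
        · have hu' : 2 * s' - t' + 3 ^ n * (e + 1) = u := by linear_combination heq + hu + htz
          by_cases hsz' : s' = 0
          · obtain ⟨g, hg, a, ha, hag, hd⟩ := hG₀
            refine key s' hs' t' ht' _ hu' ⟨g, ?_, a, ?_, Or.inr hag, hd⟩
            · rwa [if_pos hsz']
            · rwa [if_neg htz']
          · obtain ⟨g, hg, a, ha, hag, hd⟩ := hG'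
            refine key s' hs' t' ht' _ hu' ⟨g, ?_, a, ?_, Or.inr hag, hd⟩
            · rwa [if_neg hsz']
            · rwa [if_neg htz']
    · obtain ⟨g, hg, a, ha, hag, hd⟩ := h.cover e
      refine key s hs t ht e hu ⟨g, ?_, a, ?_, Or.inl ⟨hst, hag⟩, hd⟩
      · rwa [if_neg hsz]
      · rwa [if_neg htz]

lemma emod_nine_cases (u : ℤ) : u % 9 = 0 ∨ u % 9 = 1 ∨ u % 9 = 2 ∨ u % 9 = 3 ∨ u % 9 = 4 ∨
    u % 9 = 5 ∨ u % 9 = 6 ∨ u % 9 = 7 ∨ u % 9 = 8 := by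
  omega

lemma isModular_zero_two_five {τ : ℤ} (hτ : 7 ≤ τ) (hmod : τ % 9 = 6) :
    IsModular 9 {0, 2, 5, τ} where
  free := by
    simp only [Finset.mem_insert, Finset.mem_singleton]
    omega
  cover u := by
    rcases emod_nine_cases u with h | h | h | h | h | h | h | h | h
    · exact ⟨0, by simp, 0, by simp, by omega, by omega⟩
    · exact ⟨5, by simp, 0, by simp, by omega, by omega⟩
    · exact ⟨2, by simp, 2, by simp, by omega, by omega⟩
    · exact ⟨τ, by simp, 0, by simp, by omega, by omega⟩
    · exact ⟨2, by simp, 0, by simp, by omega, by omega⟩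
    · exact ⟨5, by simp, 5, by simp, by omega, by omega⟩
    · exact ⟨τ, by simp, τ, by simp, by omega, by omega⟩
    · exact ⟨τ, by simp, 5, by simp, by omega, by omega⟩
    · exact ⟨5, by simp, 2, by simp, by omega, by omega⟩

lemma isCompatible_zero_two_five {τ : ℤ} (hτ : 7 ≤ τ) (hmod : τ % 9 = 6) :
    IsCompatible 9 {0, 2, 5, τ} {2, 3, 5, 6} := by
  intro e
  rcases emod_nine_cases e with h | h | h | h | h | h | h | h | h
  · exact Or.inr ⟨⟨6, by simp, 3, by simp, by omega, by omega⟩,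
      ⟨6, by simp, 2, by simp, by omega, by omega⟩,
      ⟨τ, by simp, 2, by simp, by omega, by omega⟩⟩
  · exact Or.inl ⟨5, by simp, 0, by simp, by omega, by omega⟩
  · exact Or.inl ⟨2, by simp, 2, by simp, by omega, by omega⟩
  · exact Or.inl ⟨6, by simp, 0, by simp, by omega, by omega⟩
  · exact Or.inl ⟨2, by simp, 0, by simp, by omega, by omega⟩
  · exact Or.inl ⟨5, by simp, 5, by simp, by omega, by omega⟩
  · exact Or.inl ⟨3, by simp, 0, by simp, by omega, by omega⟩
  · exact Or.inl ⟨6, by simp, 5, by simp, by omega, by omega⟩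
  · exact Or.inl ⟨5, by simp, 2, by simp, by omega, by omega⟩

lemma isModular_zero_one_seven {τ : ℤ} (hτ : 7 ≤ τ) (hmod : τ % 9 = 3) :
    IsModular 9 {0, 1, 7, τ} where
  free := by
    simp only [Finset.mem_insert, Finset.mem_singleton]
    omega
  cover u := by
    rcases emod_nine_cases u with h | h | h | h | h | h | h | h | h
    · exact ⟨0, by simp, 0, by simp, by omega, by omega⟩
    · exact ⟨1, by simp, 1, by simp, by omega, by omega⟩
    · exact ⟨1, by simp, 0, by simp, by omega, by omega⟩
    · exact ⟨τ, by simp, τ, by simp, by omega, by omega⟩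
    · exact ⟨7, by simp, 1, by simp, by omega, by omega⟩
    · exact ⟨7, by simp, 0, by simp, by omega, by omega⟩
    · exact ⟨τ, by simp, 0, by simp, by omega, by omega⟩
    · exact ⟨7, by simp, 7, by simp, by omega, by omega⟩
    · exact ⟨τ, by simp, 7, by simp, by omega, by omega⟩

lemma isCompatible_zero_one_seven (τ : ℤ) :
    IsCompatible 9 {0, 1, 7, τ} {2, 3, 5, 6} := by
  intro e
  rcases emod_nine_cases e with h | h | h | h | h | h | h | h | h
  · exact Or.inl ⟨5, by simp, 1, by simp, by omega, by omega⟩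
  · exact Or.inl ⟨5, by simp, 0, by simp, by omega, by omega⟩
  · exact Or.inl ⟨6, by simp, 1, by simp, by omega, by omega⟩
  · exact Or.inl ⟨2, by simp, 1, by simp, by omega, by omega⟩
  · exact Or.inl ⟨2, by simp, 0, by simp, by omega, by omega⟩
  · exact Or.inl ⟨3, by simp, 1, by simp, by omega, by omega⟩
  · exact Or.inl ⟨3, by simp, 0, by simp, by omega, by omega⟩
  · exact Or.inr ⟨⟨5, by simp, 3, by simp, by omega, by omega⟩,
      ⟨5, by simp, 2, by simp, by omega, by omega⟩,
      ⟨7, by simp, 6, by simp, by omega, by omega⟩⟩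
  · exact Or.inr ⟨⟨5, by simp, 2, by simp, by omega, by omega⟩,
      ⟨6, by simp, 3, by simp, by omega, by omega⟩,
      ⟨7, by simp, 5, by simp, by omega, by omega⟩⟩

lemma isModular_two_three_five_six : IsModular 9 {2, 3, 5, 6} :=
  IsModular.of_residues (N := 9) (by norm_num) (by decide) (by decide)

/-- Modular sets modulo `3 ^ (n + 2)` whose largest element is a prescribed multiple of
`3 ^ (n + 1)`. -/
lemma exists_isModular_with_max (n : ℕ) {τ : ℤ} (hτ : 7 ≤ τ) (hmod : τ % 9 = 3 ∨ τ % 9 = 6) :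
    ∃ P : Finset ℤ, IsModular (3 ^ n * 9) P ∧ P.card = 2 ^ (n + 2) ∧ 0 ∈ P ∧ 3 ^ n * τ ∈ P ∧
      ∀ x ∈ P, 0 ≤ x ∧ x ≤ 3 ^ n * τ := by
  obtain ⟨G₀, h₀, hmix, hcard, h0, hτ0, hle⟩ : ∃ G₀ : Finset ℤ, IsModular 9 G₀ ∧
      IsCompatible 9 G₀ {2, 3, 5, 6} ∧ G₀.card = 4 ∧ 0 ∈ G₀ ∧ τ ∈ G₀ ∧ ∀ x ∈ G₀, 0 ≤ x ∧ x ≤ τ := by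
    rcases hmod with hmod | hmod
    · refine ⟨{0, 1, 7, τ}, isModular_zero_one_seven hτ hmod,
        isCompatible_zero_one_seven τ, ?_, by simp, by simp, ?_⟩
      · simp [Finset.card_insert_of_notMem, show (0 : ℤ) ≠ τ by omega, show 1 ≠ τ by omega,
          show 7 ≠ τ by omega]
      · simp only [Finset.mem_insert, Finset.mem_singleton]
        omega
    · refine ⟨{0, 2, 5, τ}, isModular_zero_two_five hτ hmod,
        isCompatible_zero_two_five hτ hmod, ?_, by simp, by simp, ?_⟩
      · simp [Finset.card_insert_of_notMem, show (0 : ℤ) ≠ τ by omega, show 2 ≠ τ by omega,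
          show 5 ≠ τ by omega]
      · simp only [Finset.mem_insert, Finset.mem_singleton]
        omega
  have hpos : (0 : ℤ) < 3 ^ n := by positivity
  refine ⟨_, isModular_fiberedSum_ite n h₀ isModular_two_three_five_six hmix, ?_, ?_, ?_, ?_⟩
  · rw [card_fiberedSum (n := 4) (by positivity) (binaryDigitSet.isModular n).free,
      binaryDigitSet.card, pow_add]
    · rfl
    · intro w _
      split_ifs
      exacts [hcard, rfl]
  · exact mem_fiberedSum.2 ⟨0, binaryDigitSet.zero_mem n, 0, by simpa using h0, by simp⟩
  · exact mem_fiberedSum.2 ⟨0, binaryDigitSet.zero_mem n, τ, by simpa using hτ0, by simp⟩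
  · intro x hx
    obtain ⟨w, hw, g, hg, rfl⟩ := mem_fiberedSum.1 hx
    have hw0 := binaryDigitSet.nonneg hw
    have hw1 := binaryDigitSet.two_mul_add_one_le hw
    split_ifs at hg with h
    · obtain ⟨hg0, hg1⟩ := hle g hg
      subst h
      constructor <;> nlinarith
    · have : 0 ≤ g ∧ g + 1 ≤ τ := by
        simp only [Finset.mem_insert, Finset.mem_singleton] at hg
        omega
      constructor <;> nlinarith

/-- The integers built from a modular set modulo `N`, enumerated by `e`, form an independent
Stanley sequence. -/
lemma exists_independent_of_enumeration {κ : ℕ} {N : ℕ} {e : ℕ → ℕ} {lam : ℤ}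
    (h0 : e 0 = 0) (hmono : ∀ i j, i < j → j < 2 ^ κ → e i < e j) (hlt : ∀ i < 2 ^ κ, e i < N)
    (hfree : ∀ i < 2 ^ κ, ∀ j < 2 ^ κ, ∀ k < 2 ^ κ,
      (N : ℤ) ∣ e i + e k - 2 * e j → i = j ∧ j = k)
    (hcover : ∀ u : ℤ, ∃ i < 2 ^ κ, ∃ j < 2 ^ κ, e j ≤ e i ∧ (N : ℤ) ∣ 2 * e i - e j - u)
    (hlam : 2 * (e (2 ^ κ - 1) : ℤ) + 1 - N = lam) :
    ∃ A : Finset ℕ, A.Nonempty ∧ ThreeFree ↑A ∧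
      ∃ a : ℕ → ℕ, IsStanleySeq A a ∧ IndependentWithChar a lam := by
  set B := 2 ^ κ with hB
  have hBpos : 0 < B := by positivity
  set a : ℕ → ℕ := fun n => e (n % B) + N * ternaryOfBinary (n / B) with ha
  have hmod : ∀ n, n % B < B := fun n => Nat.mod_lt n hBpos
  have hval : ∀ i < B, ∀ q, a (B * q + i) = e i + N * ternaryOfBinary q := by
    intro i hi q
    simp only [ha]
    rw [Nat.mul_add_mod, Nat.mod_eq_of_lt hi, Nat.mul_add_div hBpos, Nat.div_eq_of_lt hi, add_zero]
  have hamono : StrictMono a := by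
    refine strictMono_nat_of_lt_succ fun n => ?_
    have hn := Nat.div_add_mod n B
    have hr := hmod n
    rw [← hn]
    generalize n / B = q at *
    generalize n % B = r at *
    rw [hval r hr]
    by_cases h : r + 1 < B
    · rw [add_assoc, hval _ h]
      have := hmono r (r + 1) (by omega) h
      omega
    · rw [show B * q + r + 1 = B * (q + 1) + 0 by rw [mul_add]; omega, hval 0 hBpos, h0]
      have h1 := ternaryOfBinary.strictMono (Nat.lt_succ_self q)
      have h2 := hlt r hr
      calc e r + N * ternaryOfBinary q < N * (ternaryOfBinary q + 1) := by rw [mul_add]; omega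
        _ ≤ N * ternaryOfBinary (q + 1) := Nat.mul_le_mul_left N h1
        _ = _ := by ring
  have hNpos : 0 < N := (Nat.zero_le _).trans_lt (hlt 0 hBpos)
  have hafree : ThreeFree (Set.range a) := by
    rintro _ ⟨x, rfl⟩ _ ⟨y, rfl⟩ _ ⟨z, rfl⟩ hxy hyz heq
    have heq' : (a x : ℤ) + a z = 2 * a y := by exact_mod_cast heq
    simp only [ha] at heq'
    push_cast at heq'
    obtain ⟨hxy', hyz'⟩ := hfree _ (hmod x) _ (hmod y) _ (hmod z)
      ⟨2 * ternaryOfBinary (y / B) - ternaryOfBinary (x / B) - ternaryOfBinary (z / B), by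
        linear_combination heq'⟩
    rw [hxy', ← hyz'] at heq'
    have hc : (ternaryOfBinary (x / B) : ℤ) + ternaryOfBinary (z / B) =
        2 * ternaryOfBinary (y / B) :=
      mul_left_cancel₀ (b := (ternaryOfBinary (x / B) : ℤ) + ternaryOfBinary (z / B))
        (Int.natCast_pos.2 hNpos).ne' (by linear_combination heq')
    have hxz := ternaryOfBinary.eq_of_add_eq_two_mul _ _ _ (by exact_mod_cast hc)
    have : x = z := by
      rw [← Nat.div_add_mod x B, ← Nat.div_add_mod z B, hxy', hyz', hxz]
    subst this
    omega
  have hacover : ∀ m, N ≤ m → m ∉ Set.range a →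
      ∃ y z, a y < a z ∧ a z < m ∧ a y + m = 2 * a z := by
    intro m hm hmr
    obtain ⟨i, hi, j, hj, hji, c, hc⟩ := hcover m
    have hi' := hlt i hi
    have hcnonneg : 0 ≤ -c := by
      by_contra hneg
      have h1 : (1 : ℤ) ≤ c := by omega
      have h2 : (N : ℤ) ≤ N * c := le_mul_of_one_le_right (by positivity) h1
      omega
    obtain ⟨v, hv⟩ := Int.eq_ofNat_of_zero_le hcnonneg
    obtain ⟨s, t, hts, hst⟩ := ternaryOfBinary.exists_two_mul_eq_add v
    have hle : a (B * t + j) ≤ a (B * s + i) := by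
      rw [hval j hj, hval i hi]
      have := ternaryOfBinary.strictMono.monotone hts
      gcongr
    have hsum : a (B * t + j) + m = 2 * a (B * s + i) := by
      rw [hval j hj, hval i hi]
      zify at hst ⊢
      linear_combination (-1 : ℤ) * hc - N * hst + N * hv
    rcases hle.lt_or_eq with h | h
    · exact ⟨_, _, h, by omega, hsum⟩
    · exact absurd ⟨B * s + i, by omega⟩ hmr
  refine ⟨(Finset.range (2 * B)).image a, ⟨a 0, ?_⟩, ?_, a, ⟨hamono, ?_, ?_⟩, κ, ?_⟩
  · exact Finset.mem_image_of_mem a (by simpa using hBpos)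
  · intro x hx y hy z hz
    simp only [Finset.coe_image] at hx hy hz
    exact hafree x (Set.image_subset_range _ _ hx) y (Set.image_subset_range _ _ hy) z
      (Set.image_subset_range _ _ hz)
  · rw [Finset.card_image_of_injective _ hamono.injective, Finset.card_range]
    exact fun i hi => Finset.mem_image_of_mem a (Finset.mem_range.2 hi)
  · rw [Finset.card_image_of_injective _ hamono.injective, Finset.card_range]
    intro k hk
    have hrange : a '' Set.Iic k ∪ {a (k + 1)} ⊆ Set.range a := by
      rintro x (⟨i, -, rfl⟩ | rfl) <;> exact ⟨_, rfl⟩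
    refine ⟨⟨hamono (Nat.lt_succ_self k), fun x hx y hy z hz =>
      hafree x (hrange hx) y (hrange hy) z (hrange hz)⟩, ?_⟩
    rintro m ⟨hkm, hm⟩
    by_contra! hlt'
    have hNm : N ≤ m := by
      have h1 : a B ≤ a k := hamono.monotone (by omega)
      have h2 := hval 0 hBpos 1
      rw [h0, ternaryOfBinary.one] at h2
      simp only [mul_one, add_zero, zero_add] at h2
      omega
    have hmr : m ∉ Set.range a := by
      rintro ⟨i, rfl⟩
      have h1 := hamono.lt_iff_lt.1 hkm
      have h2 := hamono.lt_iff_lt.1 hlt'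
      omega
    obtain ⟨y, z, hyz, hzm, hsum⟩ := hacover m hNm hmr
    have hmem : ∀ i, a i < m → a i ∈ a '' Set.Iic k ∪ {m} := fun i hi =>
      Or.inl ⟨i, Nat.lt_succ_iff.1 (hamono.lt_iff_lt.1 (hi.trans hlt')), rfl⟩
    exact hm _ (hmem y (hyz.trans hzm)) _ (hmem z hzm) m (Or.inr rfl) hyz hzm hsum
  · intro k hk
    obtain ⟨l, rfl⟩ := Nat.exists_eq_add_of_le hk
    have hpow : a (2 ^ (κ + l)) = N * 3 ^ l := by
      have := hval 0 hBpos (2 ^ l)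
      rwa [h0, add_zero, zero_add, hB, ← pow_add, ternaryOfBinary.two_pow] at this
    rw [hpow]
    constructor
    · intro i hi
      rw [pow_add] at hi ⊢
      have hq : i / B < 2 ^ l := Nat.div_lt_of_lt_mul hi
      have hi' := Nat.div_add_mod i B
      calc a (B * 2 ^ l + i) = a (B * (2 ^ l + i / B) + i % B) := by
            congr 1; rw [mul_add]; omega
        _ = e (i % B) + N * (3 ^ l + ternaryOfBinary (i / B)) := by
            rw [hval _ (hmod i), ternaryOfBinary.two_pow_add l _ hq]
        _ = _ := by simp only [ha]; ring
    · have h2l := Nat.one_le_two_pow (n := l)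
      have hidx : 2 ^ (κ + l) - 1 = B * (2 ^ l - 1) + (B - 1) := by
        rw [pow_add, Nat.mul_sub, ← hB, mul_one]
        have : B ≤ B * 2 ^ l := Nat.le_mul_of_pos_right B (by omega)
        omega
      rw [hidx, hval _ (by omega)]
      have h3 : 2 * (ternaryOfBinary (2 ^ l - 1) : ℤ) + 1 = 3 ^ l := by
        exact_mod_cast ternaryOfBinary.two_pow_sub_one l
      push_cast
      linear_combination (-(N : ℤ)) * h3 - hlam

lemma IsModular.exists_independent {N : ℕ} {A : Finset ℤ} {κ : ℕ} {μ lam : ℤ}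
    (hA : IsModular N A) (hcard : A.card = 2 ^ κ) (h0 : 0 ∈ A) (hμ : μ ∈ A)
    (hbound : ∀ x ∈ A, 0 ≤ x ∧ x ≤ μ) (hμN : μ < N) (hlam : 2 * μ + 1 - N = lam) :
    ∃ A : Finset ℕ, A.Nonempty ∧ ThreeFree ↑A ∧
      ∃ a : ℕ → ℕ, IsStanleySeq A a ∧ IndependentWithChar a lam := by
  let f := A.orderEmbOfFin hcard
  have hfA : ∀ i, f i ∈ A := A.orderEmbOfFin_mem hcard
  have hBpos : 0 < 2 ^ κ := by positivity
  let e : ℕ → ℕ := fun i => if h : i < 2 ^ κ then (f ⟨i, h⟩).toNat else 0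
  have he : ∀ i (h : i < 2 ^ κ), (e i : ℤ) = f ⟨i, h⟩ := by
    intro i h
    simp only [e, dif_pos h]
    exact Int.toNat_of_nonneg (hbound _ (hfA _)).1
  have hsurj : ∀ x ∈ A, ∃ i, ∃ h : i < 2 ^ κ, f ⟨i, h⟩ = x := by
    intro x hx
    have : x ∈ Set.range f := by
      rw [Finset.range_orderEmbOfFin]
      exact hx
    obtain ⟨i, rfl⟩ := this
    exact ⟨i, i.2, rfl⟩
  have hzero : e 0 = 0 := by
    obtain ⟨i, hi, hfi⟩ := hsurj 0 h0
    have h1 : f ⟨0, hBpos⟩ ≤ f ⟨i, hi⟩ := f.monotone (Nat.zero_le i)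
    have h2 := he 0 hBpos
    have h3 := (hbound _ (hfA ⟨0, hBpos⟩)).1
    omega
  have hlast : (e (2 ^ κ - 1) : ℤ) = μ := by
    obtain ⟨i, hi, hfi⟩ := hsurj μ hμ
    have hl : 2 ^ κ - 1 < 2 ^ κ := by omega
    have h1 : f ⟨i, hi⟩ ≤ f ⟨2 ^ κ - 1, hl⟩ := f.monotone (Nat.le_sub_one_of_lt hi)
    have h2 := he _ hl
    have h3 := (hbound _ (hfA ⟨2 ^ κ - 1, hl⟩)).2
    omega
  refine exists_independent_of_enumeration (κ := κ) (N := N) (e := e) hzero ?_ ?_ ?_ ?_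
    (by rw [hlast]; exact hlam)
  · intro i j hij hj
    have h1 : f ⟨i, hij.trans hj⟩ < f ⟨j, hj⟩ := f.strictMono hij
    have h2 := he i (hij.trans hj)
    have h3 := he j hj
    omega
  · intro i hi
    have h1 := he i hi
    have h2 := (hbound _ (hfA ⟨i, hi⟩)).2
    omega
  · intro i hi j hj k hk h
    rw [he i hi, he j hj, he k hk] at h
    simpa using hA.free _ (hfA _) _ (hfA _) _ (hfA _) h
  · intro u
    obtain ⟨s, hs, t, ht, hts, hdvd⟩ := hA.cover u
    obtain ⟨i, hi, rfl⟩ := hsurj s hs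
    obtain ⟨j, hj, rfl⟩ := hsurj t ht
    refine ⟨i, hi, j, hj, ?_, ?_⟩
    · zify
      rwa [he i hi, he j hj]
    · rwa [he i hi, he j hj]

/-- Every character `30 * (3 ^ n * q) + 1` with `4 ≤ q` prime to `3` is attained. -/
lemma exists_independent_of_not_dvd (n : ℕ) {q : ℕ} (hq : 4 ≤ q) (hq3 : ¬ 3 ∣ q) :
    ∃ A : Finset ℕ, A.Nonempty ∧ ThreeFree ↑A ∧
      ∃ a : ℕ → ℕ, IsStanleySeq A a ∧ IndependentWithChar a (30 * (3 ^ n * q) + 1) := by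
  set τ : ℤ := 15 * q - 27 with hτ
  have hL : (0 : ℤ) < 3 ^ n := by positivity
  obtain ⟨P, hP, hPcard, hP0, hPτ, hPle⟩ :=
    exists_isModular_with_max n (τ := τ) (by omega) (by omega)
  set k : ℕ := 15 * q with hk
  have hkpow : (k : ℤ) < 3 ^ k := by exact_mod_cast k.lt_pow_self (by norm_num)
  set F := fiberedSum 10 {0, 1, 7, 8} fun _ => binaryDigitSet k with hF
  have hFmod : IsModular (10 * 3 ^ k) F :=
    isModular_ten.mul (by norm_num) (binaryDigitSet.isModular k)
  have hFcard : F.card = 2 ^ (k + 2) := by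
    rw [hF, card_fiberedSum (by norm_num) isModular_ten.free fun _ _ => binaryDigitSet.card k,
      pow_add, mul_comm]
    rfl
  obtain ⟨b, hb, hbmax⟩ := binaryDigitSet.exists_max k
  have hF0 : 0 ∈ F := mem_fiberedSum.2 ⟨0, by simp, 0, binaryDigitSet.zero_mem k, by simp⟩
  have hFmax : 8 + 10 * b ∈ F := mem_fiberedSum.2 ⟨8, by simp, b, hb, rfl⟩
  have hFle : ∀ x ∈ F, 0 ≤ x ∧ x ≤ 8 + 10 * b := by
    intro x hx
    obtain ⟨d, hd, y, hy, rfl⟩ := mem_fiberedSum.1 hx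
    have h1 := binaryDigitSet.nonneg hy
    have h2 := binaryDigitSet.two_mul_add_one_le hy
    simp only [Finset.mem_insert, Finset.mem_singleton] at hd
    omega
  have hA := hP.mul (by positivity) hFmod
  refine IsModular.exists_independent (N := 3 ^ n * 9 * (10 * 3 ^ k))
    (A := fiberedSum (3 ^ n * 9) P fun _ => F) (κ := n + 2 + (k + 2))
    (μ := 3 ^ n * τ + 3 ^ n * 9 * (8 + 10 * b)) (by exact_mod_cast hA) ?_ ?_ ?_ ?_ ?_ ?_
  · rw [card_fiberedSum (by positivity) hP.free fun _ _ => hFcard, hPcard, ← pow_add]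
  · exact mem_fiberedSum.2 ⟨0, hP0, 0, hF0, by simp⟩
  · exact mem_fiberedSum.2 ⟨_, hPτ, _, hFmax, rfl⟩
  · intro x hx
    obtain ⟨p, hp, g, hg, rfl⟩ := mem_fiberedSum.1 hx
    obtain ⟨hp0, hp1⟩ := hPle p hp
    obtain ⟨hg0, hg1⟩ := hFle g hg
    exact ⟨by positivity, by gcongr⟩
  · push_cast
    have : τ + 9 * (8 + 10 * b) < 9 * (10 * 3 ^ k) := by omega
    nlinarith
  · push_cast
    linear_combination 90 * 3 ^ n * hbmax + 2 * 3 ^ n * hτ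

theorem characters_one_mod_thirty (lam : ℕ) (hgt : 1 < lam) (hmod : lam % 30 = 1)
    (hexc : ∀ n : ℕ, 0 < n → lam ≠ 10 * 3 ^ n + 1 ∧ lam ≠ 20 * 3 ^ n + 1) :
    ∃ A : Finset ℕ, A.Nonempty ∧ ThreeFree ↑A ∧
      ∃ a : ℕ → ℕ, IsStanleySeq A a ∧ IndependentWithChar a (lam : ℤ) := by
  obtain ⟨n, q, hq3, hnq⟩ := Nat.exists_eq_pow_mul_and_not_dvd
    (n := lam / 30) (by omega) 3 (by norm_num)
  have hlam : lam = 30 * (3 ^ n * q) + 1 := by omega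
  have hq : 4 ≤ q := by
    by_contra! h
    have := hexc (n + 1) n.succ_pos
    rw [pow_succ] at this
    interval_cases q <;> omega
  rw [hlam]
  exact_mod_cast exists_independent_of_not_dvd n hq hq3
end

section
/- For every odd integer λ ≥ 87 with λ ≢ 1 (mod 14), there exists a finite 3-free set A of nonnegative integers such that the Stanley sequence S(A) is independent with character λ. -/
/-- All base-`3` digits of `n` are `0` or `1`. -/
def Tern (n : ℕ) : Prop := ∀ d ∈ Nat.digits 3 n, d ≤ 1

theorem tern_iff (n : ℕ) : Tern n ↔ n % 3 ≤ 1 ∧ Tern (n / 3) := by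
  rcases Nat.eq_zero_or_pos n with rfl | hn
  · simp [Tern]
  · unfold Tern
    rw [Nat.digits_def' (by norm_num) hn]
    simp

theorem tern_zero : Tern 0 := by simp [Tern]

theorem Tern.eq_of_add_eq_two_mul {x y z : ℕ} (hx : Tern x) (hy : Tern y) (hz : Tern z)
    (h : x + z = 2 * y) : x = z := by
  induction y using Nat.strong_induction_on generalizing x z with
  | _ y ih =>
    rcases Nat.eq_zero_or_pos y with rfl | hpos
    · omega
    · rw [tern_iff] at hx hy hz
      have := ih (y / 3) (by omega) hx.2 hy.2 hz.2 (by omega)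
      omega

theorem exists_tern_add_eq_two_mul (t : ℕ) :
    ∃ u v, Tern u ∧ Tern v ∧ u ≤ v ∧ t + u = 2 * v := by
  induction t using Nat.strong_induction_on with
  | _ t ih =>
    rcases Nat.eq_zero_or_pos t with rfl | hpos
    · exact ⟨0, 0, tern_zero, tern_zero, le_rfl, rfl⟩
    · obtain ⟨u, v, hu, hv, huv, h⟩ := ih (t / 3) (by omega)
      have key : ∀ w d, Tern w → d ≤ 1 → Tern (3 * w + d) := fun w d hw hd => by
        rw [tern_iff]
        refine ⟨by omega, ?_⟩
        rwa [show (3 * w + d) / 3 = w by omega]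
      have : t % 3 = 0 ∨ t % 3 = 1 ∨ t % 3 = 2 := by omega
      rcases this with h3 | h3 | h3
      · exact ⟨3 * u + 0, 3 * v + 0, key u 0 hu (by norm_num), key v 0 hv (by norm_num),
          by omega, by omega⟩
      · exact ⟨3 * u + 1, 3 * v + 1, key u 1 hu (by norm_num), key v 1 hv (by norm_num),
          by omega, by omega⟩
      · exact ⟨3 * u + 0, 3 * v + 1, key u 0 hu (by norm_num), key v 1 hv (by norm_num),
          by omega, by omega⟩

theorem tern_three_pow_add_iff {j s : ℕ} (hs : s < 3 ^ j) : Tern (3 ^ j + s) ↔ Tern s := by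
  induction j generalizing s with
  | zero =>
    obtain rfl : s = 0 := by simpa using hs
    simp [Tern]
  | succ j ih =>
    rw [pow_succ] at hs ⊢
    rw [tern_iff, tern_iff s, show (3 ^ j * 3 + s) / 3 = 3 ^ j + s / 3 by omega,
      show (3 ^ j * 3 + s) % 3 = s % 3 by omega, ih (by omega)]

theorem Tern.two_mul_lt {j n : ℕ} (hn : Tern n) (h : n < 3 ^ j) : 2 * n < 3 ^ j := by
  induction j generalizing n with
  | zero => simp at h; simp [h]
  | succ j ih =>
    rw [pow_succ] at h ⊢
    rw [tern_iff] at hn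
    have := ih hn.2 (by omega)
    omega

theorem exists_tern_two_mul_add_one (j : ℕ) : ∃ s, Tern s ∧ 2 * s + 1 = 3 ^ j := by
  induction j with
  | zero => exact ⟨0, tern_zero, rfl⟩
  | succ j ih =>
    obtain ⟨s, hs, h⟩ := ih
    exact ⟨3 ^ j + s, (tern_three_pow_add_iff (by omega)).2 hs, by rw [pow_succ]; omega⟩

open Classical in
theorem count_tern (j : ℕ) : Nat.count Tern (3 ^ j) = 2 ^ j := by
  induction j with
  | zero => rw [pow_zero, pow_zero, ← zero_add 1, Nat.count_succ, if_pos tern_zero, Nat.count_zero]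
  | succ j ih =>
    have h1 : Nat.count (fun k => Tern (3 ^ j + k)) (3 ^ j) = 2 ^ j := by
      rw [← ih, Nat.count_eq_card_filter_range, Nat.count_eq_card_filter_range]
      congr 1
      refine Finset.filter_congr fun s hs => ?_
      exact tern_three_pow_add_iff (Finset.mem_range.1 hs)
    have h2 : Nat.count (fun k => Tern (3 ^ j + 3 ^ j + k)) (3 ^ j) = 0 := by
      rw [Nat.count_eq_card_filter_range, Finset.card_eq_zero, Finset.filter_eq_empty_iff]
      intro s hs hT
      have hs := Finset.mem_range.1 hs
      have := hT.two_mul_lt (j := j + 1) (by rw [pow_succ]; omega)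
      rw [pow_succ] at this
      omega
    rw [show 3 ^ (j + 1) = 3 ^ j + 3 ^ j + 3 ^ j by ring, Nat.count_add, Nat.count_add, ih, h1, h2]
    ring

/-- The values of `e` form a set of representatives of a modular set modulo `N`: their residues
are free of three-term progressions, and every other residue completes a progression whose
first two terms are values of `e` taken in increasing order of the index. -/
def IsModular_s12 (N : ℕ) {n : ℕ} (e : Fin n → ℕ) : Prop :=
  (∀ i j k, (e i + e k) % N = (2 * e j) % N → i = j ∧ k = j) ∧
  ∀ r < N, (∃ i, r = e i % N) ∨ ∃ i j, i < j ∧ (r + e i) % N = (2 * e j) % N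

instance (N : ℕ) {n : ℕ} (e : Fin n → ℕ) : Decidable (IsModular_s12 N e) := by
  unfold IsModular_s12; infer_instance

theorem IsModular_s12.congr {N n : ℕ} {e f : Fin n → ℕ} (he : IsModular_s12 N e)
    (h : ∀ i, f i ≡ e i [MOD N]) : IsModular_s12 N f := by
  refine ⟨fun i j k hijk => he.1 i j k ?_, fun r hr => ?_⟩
  · exact (((h i).add (h k)).symm.trans hijk).trans ((h j).mul_left 2)
  · rcases he.2 r hr with ⟨i, hi⟩ | ⟨i, j, hij, hr⟩
    · exact .inl ⟨i, hi.trans (h i).symm⟩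
    · exact .inr ⟨i, j, hij, (((h i).add_left r).trans hr).trans ((h j).mul_left 2).symm⟩

/-- The set of all `e i + N * s` where `s` has only the digits `0` and `1` in base `3`. -/
def ternExtension (N : ℕ) {n : ℕ} (e : Fin n → ℕ) : Set ℕ :=
  {m | ∃ i s, Tern s ∧ m = e i + N * s}

section

variable {N n : ℕ} {e : Fin n → ℕ}

theorem IsModular_s12.injective (he : IsModular_s12 N e) {i j : Fin n} (h : e i ≡ e j [MOD N]) :
    i = j :=
  (he.1 i j j (by have := h.add_right (e j); rwa [← two_mul] at this)).1

theorem IsModular_s12.threeFree (hN : 0 < N) (he : IsModular_s12 N e) :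
    ThreeFree (ternExtension N e) := by
  rintro _ ⟨i, s, hs, rfl⟩ _ ⟨j, t, ht, rfl⟩ _ ⟨k, u, hu, rfl⟩ hxy hyz h
  obtain ⟨rfl, rfl⟩ := he.1 i j k (by
    have := congrArg (· % N) h
    simpa [Nat.add_mod, Nat.mul_mod] using this)
  have h' : N * (s + u) = N * (2 * t) := by linarith
  have := hs.eq_of_add_eq_two_mul ht hu (Nat.eq_of_mul_eq_mul_left hN h')
  subst this
  omega

theorem IsModular_s12.covers {α : ℕ} (hN : 0 < N) (he : IsModular_s12 N e) (hmono : StrictMono e)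
    (hα : ∀ i, e i ≤ α) {m : ℕ} (hm : 2 * α ≤ m) (hmT : m ∉ ternExtension N e) :
    ∃ x ∈ ternExtension N e, ∃ y ∈ ternExtension N e, x < y ∧ y < m ∧ x + m = 2 * y := by
  suffices h : ∃ x ∈ ternExtension N e, ∃ y ∈ ternExtension N e, x < y ∧ x + m = 2 * y by
    obtain ⟨x, hx, y, hy, hxy, h⟩ := h
    exact ⟨x, hx, y, hy, hxy, by omega, h⟩
  rcases he.2 (m % N) (Nat.mod_lt _ hN) with ⟨i, hi⟩ | ⟨i, j, hij, h⟩
  · have hle : e i ≤ m := by have := hα i; omega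
    obtain ⟨t, ht⟩ := (Nat.modEq_iff_dvd' hle).1 (show e i ≡ m [MOD N] from hi.symm)
    obtain ⟨u, v, hu, hv, huv, h⟩ := exists_tern_add_eq_two_mul t
    have hne : u ≠ v := by
      rintro rfl
      exact hmT ⟨i, t, by rwa [show t = u by omega], by omega⟩
    refine ⟨_, ⟨i, u, hu, rfl⟩, _, ⟨i, v, hv, rfl⟩, ?_, ?_⟩
    · have := Nat.mul_lt_mul_of_pos_left (lt_of_le_of_ne huv hne) hN
      omega
    · have : m = e i + N * t := by omega
      rw [this]
      linear_combination N * h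
  · have hle : 2 * e j ≤ m + e i := by have := hα j; omega
    rw [Nat.mod_add_mod] at h
    obtain ⟨t, ht⟩ := (Nat.modEq_iff_dvd' hle).1 (show 2 * e j ≡ m + e i [MOD N] from h.symm)
    obtain ⟨u, v, hu, hv, huv, h⟩ := exists_tern_add_eq_two_mul t
    refine ⟨_, ⟨i, u, hu, rfl⟩, _, ⟨j, v, hv, rfl⟩, ?_, ?_⟩
    · have := Nat.mul_le_mul_left N huv
      have := hmono hij
      omega
    · have : m + e i = 2 * e j + N * t := by omega
      linear_combination this + N * h

theorem mul_three_pow_add_mem_iff {α j t : ℕ} (hN : 0 < N) (hα : ∀ i, e i ≤ α)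
    (hj : 2 * α < N * 3 ^ j) (ht : t < N * 3 ^ j) :
    N * 3 ^ j + t ∈ ternExtension N e ↔ t ∈ ternExtension N e := by
  constructor
  · rintro ⟨i, s, hs, h⟩
    have hi := hα i
    have h1 : 3 ^ j ≤ s := by
      by_contra! hlt
      have := Nat.mul_lt_mul_of_pos_left (hs.two_mul_lt hlt) hN
      nlinarith
    obtain ⟨u, rfl⟩ := Nat.exists_eq_add_of_le h1
    rw [mul_add] at h
    have hu : u < 3 ^ j := Nat.lt_of_mul_lt_mul_left (a := N) (by omega)
    exact ⟨i, u, (tern_three_pow_add_iff hu).1 hs, by omega⟩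
  · rintro ⟨i, s, hs, rfl⟩
    have hlt : s < 3 ^ j := Nat.lt_of_mul_lt_mul_left (a := N) (by omega)
    exact ⟨i, 3 ^ j + s, (tern_three_pow_add_iff hlt).2 hs, by ring⟩

open Classical in
theorem IsModular_s12.count_mul_three_pow {α j : ℕ} (hN : 0 < N) (he : IsModular_s12 N e)
    (hα : ∀ i, e i ≤ α) (hj : 2 * α < N * 3 ^ j) :
    Nat.count (· ∈ ternExtension N e) (N * 3 ^ j) = n * 2 ^ j := by
  have himg : (Finset.range (N * 3 ^ j)).filter (· ∈ ternExtension N e) =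
      (Finset.univ ×ˢ (Finset.range (3 ^ j)).filter Tern).image
        (fun p : Fin n × ℕ => e p.1 + N * p.2) := by
    ext m
    simp only [Finset.mem_filter, Finset.mem_range, Finset.mem_image, Finset.mem_product,
      Finset.mem_univ, true_and, Prod.exists]
    constructor
    · rintro ⟨hm, i, s, hs, rfl⟩
      exact ⟨i, s, ⟨Nat.lt_of_mul_lt_mul_left (a := N) (by omega), hs⟩, rfl⟩
    · rintro ⟨i, s, ⟨hlt, hs⟩, rfl⟩
      refine ⟨?_, i, s, hs, rfl⟩
      have := Nat.mul_le_mul_left N (hs.two_mul_lt hlt)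
      have := hα i
      nlinarith
  rw [Nat.count_eq_card_filter_range, himg, Finset.card_image_of_injective, Finset.card_product,
    ← Nat.count_eq_card_filter_range, count_tern, Finset.card_univ, Fintype.card_fin]
  rintro ⟨i, s⟩ ⟨k, t⟩ h
  have h : e i + N * s = e k + N * t := h
  obtain rfl := he.injective (i := i) (j := k) (by
    have := congrArg (· % N) h
    simpa [Nat.ModEq] using this)
  have := Nat.eq_of_mul_eq_mul_left hN (Nat.add_left_cancel h)
  rw [this]

end

/-- A modular set with `2 ^ p` representatives, the least being `0` and the largest `α`, yields
an independent Stanley sequence with character `2 * α + 1 - N`. -/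
theorem IsModular_s12.exists_independent {N p α : ℕ} {e : Fin (2 ^ p) → ℕ} (hN : 0 < N)
    (he : IsModular_s12 N e) (hmono : StrictMono e) (hα : ∀ i, e i ≤ α) (hmin : ∃ i, e i = 0)
    (hmax : ∃ i, e i = α) :
    ∃ A : Finset ℕ, A.Nonempty ∧ ThreeFree ↑A ∧
      ∃ a : ℕ → ℕ, IsStanleySeq A a ∧ IndependentWithChar a (2 * α + 1 - N) := by
  classical
  set T := ternExtension N e with hT
  obtain ⟨i₀, hi₀⟩ := hmin
  obtain ⟨i₁, hi₁⟩ := hmax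
  have hlarge : ∀ j, 2 * α ≤ j → 2 * α < N * 3 ^ j := fun j hj => by
    have : j < 3 ^ j := Nat.lt_pow_self (by norm_num)
    nlinarith
  have hpow : ∀ j, N * 3 ^ j ∈ T := fun j => by
    have h := (tern_three_pow_add_iff (j := j) (s := 0) (by positivity)).2 tern_zero
    exact ⟨i₀, 3 ^ j, h, by rw [hi₀, zero_add]⟩
  have hinf : (Set.ofPred (· ∈ T)).Infinite := by
    refine Set.infinite_of_not_bddAbove ?_
    rintro ⟨b, hb⟩
    have h1 := hb (hpow b)
    have : b < 3 ^ b := Nat.lt_pow_self (by norm_num)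
    nlinarith
  have hsm : StrictMono (Nat.nth (· ∈ T)) := Nat.nth_strictMono hinf
  have hmem : ∀ k, Nat.nth (· ∈ T) k ∈ T := Nat.nth_mem_of_infinite hinf
  have hcount : ∀ {m}, m ∈ T → Nat.nth (· ∈ T) (Nat.count (· ∈ T) m) = m := fun hm =>
    Nat.nth_count (p := (· ∈ T)) hm
  have hfree : ThreeFree T := he.threeFree hN
  have hmemlt : ∀ {m k}, m ∈ T → m < Nat.nth (· ∈ T) (k + 1) →
      m ∈ Nat.nth (· ∈ T) '' Set.Iic k := fun {m k} hm hlt => by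
    refine ⟨_, ?_, hcount hm⟩
    rw [← hcount hm] at hlt
    exact Nat.lt_succ_iff.1 (hsm.lt_iff_lt.1 hlt)
  obtain ⟨L, hLT, hαL⟩ : ∃ L ∈ T, 2 * α < L := ⟨_, hpow (2 * α), hlarge _ le_rfl⟩
  refine ⟨(Finset.range (L + 1)).filter (· ∈ T), ⟨L, by simp [hLT]⟩, ?_,
    Nat.nth (· ∈ T), ⟨hsm, ?_, ?_⟩, ?_⟩
  · intro x hx y hy z hz
    simp only [Finset.coe_filter, Set.mem_ofPred_eq] at hx hy hz
    exact hfree x hx.2 y hy.2 z hz.2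
  · intro i hi
    rw [← Nat.count_eq_card_filter_range] at hi
    simp only [Finset.mem_filter, Finset.mem_range]
    exact ⟨Nat.nth_lt_of_lt_count hi, hmem i⟩
  · intro k hk
    rw [← Nat.count_eq_card_filter_range, Nat.count_succ, if_pos hLT] at hk
    have hLk : L ≤ Nat.nth (· ∈ T) k := by
      rw [← hcount hLT]
      exact hsm.monotone (Nat.le_of_succ_le_succ hk)
    refine ⟨⟨hsm (Nat.lt_succ_self k), ?_⟩, ?_⟩
    · have hsub : Nat.nth (· ∈ T) '' Set.Iic k ∪ {Nat.nth (· ∈ T) (k + 1)} ⊆ T := by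
        rintro _ (⟨i, -, rfl⟩ | rfl)
        · exact hmem i
        · exact hmem _
      exact fun x hx y hy z hz => hfree x (hsub hx) y (hsub hy) z (hsub hz)
    · rintro m ⟨hkm, hm⟩
      by_contra! hlt
      have hmT : m ∉ T := fun hmT => by
        obtain ⟨i, hi, rfl⟩ := hmemlt hmT hlt
        exact absurd (hsm.lt_iff_lt.1 hkm) (not_lt.2 hi)
      obtain ⟨x, hx, y, hy, hxy, hym, h⟩ := he.covers hN hmono hα
        (by omega) hmT
      exact hm x (.inl (hmemlt hx (by omega))) y (.inl (hmemlt hy (by omega))) m (.inr rfl)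
        hxy hym h
  · refine ⟨p + 2 * α, fun k hk => ?_⟩
    obtain ⟨j, rfl⟩ : ∃ j, k = p + j := ⟨k - p, by omega⟩
    have hj := hlarge j (by omega)
    have hc : Nat.count (· ∈ T) (N * 3 ^ j) = 2 ^ (p + j) := by
      rw [hT, he.count_mul_three_pow hN hα hj, pow_add]
    have hnth : Nat.nth (· ∈ T) (2 ^ (p + j)) = N * 3 ^ j := by rw [← hc, hcount (hpow j)]
    refine ⟨fun i hi => ?_, ?_⟩
    · rw [hnth]
      have hlt : Nat.nth (· ∈ T) i < N * 3 ^ j := by rw [← hnth]; exact hsm hi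
      have hin := (mul_three_pow_add_mem_iff hN hα hj hlt).2 (hmem i)
      rw [← hcount hin, Nat.count_add, hc]
      congr 2
      conv_lhs => rw [← Nat.count_nth_of_infinite hinf i]
      rw [Nat.count_eq_card_filter_range, Nat.count_eq_card_filter_range]
      congr 1
      refine Finset.filter_congr fun t ht => ?_
      exact (mul_three_pow_add_mem_iff hN hα hj ((Finset.mem_range.1 ht).trans hlt)).symm
    · obtain ⟨s, hs, hsj⟩ := exists_tern_two_mul_add_one j
      have hlast : Nat.nth (· ∈ T) (2 ^ (p + j) - 1) = α + N * s := by
        have hpos : 0 < 2 ^ (p + j) := by positivity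
        apply le_antisymm
        · have hlt : Nat.nth (· ∈ T) (2 ^ (p + j) - 1) < N * 3 ^ j := by
            rw [← hnth]; exact hsm (by omega)
          obtain ⟨i, t, ht, h⟩ := hmem (2 ^ (p + j) - 1)
          rw [h] at hlt ⊢
          have htj : t < 3 ^ j := Nat.lt_of_mul_lt_mul_left (a := N) (by omega)
          have := ht.two_mul_lt htj
          exact Nat.add_le_add (hα i) (Nat.mul_le_mul_left N (by omega))
        · have hin : α + N * s ∈ T := ⟨i₁, s, hs, by rw [hi₁]⟩
          have hlt : α + N * s < N * 3 ^ j := by rw [← hsj] at hj ⊢; nlinarith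
          rw [← hnth, ← hcount hin] at hlt
          have := hsm.lt_iff_lt.1 hlt
          rw [← hcount hin]
          exact hsm.monotone (by omega)
      rw [hnth, hlast, ← hsj]
      push_cast
      ring

/-- For `r` not divisible by `7`, representatives of a modular set modulo `28`, the largest of
which is congruent to `r`. -/
def modularTable : Fin 28 → Fin (2 ^ 3) → ℕ :=
  ![![0, 0, 0, 0, 0, 0, 0, 0],
    ![0, 3, 4, 19, 22, 23, 48, 57],
    ![0, 5, 13, 18, 22, 35, 45, 58],
    ![0, 1, 9, 10, 12, 13, 32, 59],
    ![0, 1, 3, 19, 20, 22, 23, 60],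
    ![0, 3, 11, 15, 16, 26, 48, 61],
    ![0, 1, 10, 25, 26, 35, 37, 62],
    ![0, 0, 0, 0, 0, 0, 0, 0],
    ![0, 9, 12, 27, 31, 39, 58, 64],
    ![0, 3, 11, 27, 40, 58, 64, 65],
    ![0, 1, 3, 9, 12, 32, 41, 66],
    ![0, 3, 9, 27, 30, 36, 40, 67],
    ![0, 1, 3, 9, 10, 32, 41, 68],
    ![0, 1, 3, 9, 10, 12, 32, 69],
    ![0, 0, 0, 0, 0, 0, 0, 0],
    ![0, 5, 9, 17, 20, 22, 32, 71],
    ![0, 1, 20, 25, 26, 45, 47, 72],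
    ![0, 1, 19, 20, 25, 26, 44, 73],
    ![0, 1, 24, 33, 44, 67, 69, 74],
    ![0, 1, 16, 17, 25, 26, 48, 75],
    ![0, 1, 16, 17, 25, 26, 47, 76],
    ![0, 0, 0, 0, 0, 0, 0, 0],
    ![0, 1, 3, 4, 19, 20, 23, 78],
    ![0, 1, 3, 4, 19, 20, 22, 79],
    ![0, 5, 13, 16, 18, 29, 39, 80],
    ![0, 8, 23, 41, 45, 58, 68, 81],
    ![0, 1, 9, 10, 34, 35, 53, 82],
    ![0, 5, 9, 25, 36, 62, 80, 83]]

theorem modularTable_spec : ∀ r : Fin 28, (r : ℕ) % 7 ≠ 0 →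
    IsModular_s12 28 (modularTable r) ∧ (∀ i j, i < j → modularTable r i < modularTable r j) ∧
      modularTable r 0 = 0 ∧ modularTable r 7 % 28 = r ∧ modularTable r 7 < 57 + 28 := by
  decide +kernel

theorem characters_not_one_mod_fourteen (lam : ℕ) (hodd : Odd lam) (hge : 87 ≤ lam)
    (hmod : lam % 14 ≠ 1) :
    ∃ A : Finset ℕ, A.Nonempty ∧ ThreeFree ↑A ∧
      ∃ a : ℕ → ℕ, IsStanleySeq A a ∧ IndependentWithChar a (lam : ℤ) := by
  have hα : 57 ≤ (lam + 27) / 2 := by omega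
  have hlam : (lam : ℤ) = 2 * ((lam + 27) / 2 : ℕ) + 1 - (28 : ℕ) := by
    obtain ⟨k, rfl⟩ := hodd
    omega
  have hα7 : (lam + 27) / 2 % 28 % 7 ≠ 0 := by
    obtain ⟨k, rfl⟩ := hodd
    omega
  rw [hlam]
  generalize (lam + 27) / 2 = α at hα hα7
  obtain ⟨hmodular, hlt, hzero, hlast, hbound⟩ :=
    modularTable_spec ⟨α % 28, Nat.mod_lt _ (by norm_num)⟩ hα7
  generalize modularTable ⟨α % 28, Nat.mod_lt _ (by norm_num)⟩ = e at *
  have hle : e 7 ≤ α := by simp only at hlast; omega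
  have hmono : StrictMono (Function.update e 7 α) := by
    intro i j hij
    have hi : i ≠ 7 := (lt_of_lt_of_le hij (Fin.le_last j)).ne
    rw [Function.update_of_ne hi]
    by_cases hj : j = 7
    · rw [hj] at hij ⊢
      rw [Function.update_self]
      exact (hlt i 7 hij).trans_le hle
    · rw [Function.update_of_ne hj]
      exact hlt i j hij
  refine IsModular_s12.exists_independent (p := 3) (by norm_num) (hmodular.congr fun i => ?_) hmono
    (fun i => ?_) ⟨0, ?_⟩ ⟨7, Function.update_self ..⟩
  · by_cases hi : i = 7
    · rw [hi, Function.update_self]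
      exact hlast.symm
    · rw [Function.update_of_ne hi]
  · calc _ ≤ _ := hmono.monotone (Fin.le_last i)
      _ = α := Function.update_self (7 : Fin (2 ^ 3)) α e
  · rw [Function.update_of_ne (by decide), hzero]
end

section
/- Let S(A) = (a_k) be an independent Stanley sequence with character λ, where A is a finite 3-free set of nonnegative integers. Then every nonnegative integer z that is not a term of S(A) and is not covered by S(A) (i.e., z ≠ 2·a_j − a_i for all indices i < j) satisfies z < λ. -/
/-- Every integer beyond the initial segment of a Stanley sequence is a term or is covered. -/
theorem IsStanleySeq.exists_covering {A : Finset ℕ} {a : ℕ → ℕ} (ha : IsStanleySeq A a)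
    {m t : ℕ} (hm : A.card ≤ m + 1) (hmt : a m < t) (ht : ∀ k, a k ≠ t) :
    ∃ i j, i < j ∧ t + a i = 2 * a j := by
  obtain ⟨hmono, -, hgreedy⟩ := ha
  have hex : ∃ n, t < a n := ⟨t + 1, hmono.le_apply⟩
  obtain ⟨n, hn, hmin⟩ : ∃ n, t < a n ∧ ∀ l < n, ¬ t < a l :=
    ⟨Nat.find hex, Nat.find_spec hex, fun _ => Nat.find_min hex⟩
  have hmn : m < n := hmono.lt_iff_lt.1 (hmt.trans hn)
  obtain ⟨k, rfl⟩ : ∃ k, n = k + 1 := ⟨n - 1, by omega⟩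
  have hkt : a k < t := lt_of_le_of_ne (not_lt.1 (hmin k k.lt_succ_self)) (ht k)
  obtain ⟨⟨-, hfree⟩, hleast⟩ := hgreedy k (by omega)
  have hle : ∀ i ∈ Set.Iic k, a i ≤ a k := fun i hi => hmono.monotone hi
  by_contra! hcov
  refine hn.not_ge (hleast ⟨hkt, ?_⟩)
  intro x hx y hy w hw hxy hyw hap
  have mem_of_lt : ∀ v ∈ a '' Set.Iic k ∪ {t}, v < t → v ∈ a '' Set.Iic k :=
    fun v hv hvt => hv.resolve_right hvt.ne
  have hwt : w ≤ t := by
    rcases hw with ⟨l, hl, rfl⟩ | rfl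
    · exact (hle l hl).trans hkt.le
    · exact le_rfl
  have hx' := mem_of_lt x hx (by omega)
  have hy' := mem_of_lt y hy (by omega)
  rcases hw with hw | rfl
  · exact hfree x (.inl hx') y (.inl hy') w (.inl hw) hxy hyw hap
  · obtain ⟨i, -, rfl⟩ := hx'
    obtain ⟨j, -, rfl⟩ := hy'
    exact hcov i j (hmono.lt_iff_lt.1 hxy) (by omega)

theorem omitted_lt_character (A : Finset ℕ) (hA : A.Nonempty) (h3 : ThreeFree ↑A)
    (a : ℕ → ℕ) (ha : IsStanleySeq A a) (lam : ℤ) (hind : IndependentWithChar a lam)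
    (z : ℕ) (hz1 : ∀ k, a k ≠ z)
    (hz2 : ∀ i j : ℕ, i < j → (z : ℤ) ≠ 2 * (a j : ℤ) - (a i : ℤ)) :
    (z : ℤ) < lam := by
  obtain ⟨κ, hκ⟩ := hind
  have hmono := ha.1
  by_contra! hlam
  obtain ⟨k, hκk, hkl⟩ : ∃ k, κ ≤ k ∧ A.card + 2 * z + lam.natAbs + 2 ≤ k :=
    ⟨_, le_max_left _ _, le_max_right _ _⟩
  obtain ⟨htrans, hchar⟩ := hκ k hκk
  have hpow : k < 2 ^ k := Nat.lt_two_pow_self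
  generalize 2 ^ k = N at *
  have hlast : N - 1 ≤ a (N - 1) := hmono.le_apply
  have hshift : ∀ m, N ≤ m → a m ≤ a N + z → ∃ i, m = N + i ∧ a m = a N + a i := by
    intro m hNm hmz
    have hend := htrans (N - 1) (by omega)
    have hlt : m < N + (N - 1) := hmono.lt_iff_lt.1 (by omega)
    obtain ⟨i, rfl⟩ := Nat.exists_eq_add_of_le hNm
    exact ⟨i, rfl, htrans i (by omega)⟩
  have hnot : ∀ m, a m ≠ a N + z := by
    intro m hm
    obtain ⟨i, -, hi⟩ := hshift m (hmono.le_iff_le.1 (by omega)) hm.le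
    exact hz1 i (by omega)
  have hbefore : a (N - 1) < a N := hmono (by omega)
  obtain ⟨i, j, hij, hcov⟩ :=
    ha.exists_covering (m := N - 1) (t := a N + z) (by omega) (by omega) hnot
  have hij' : a i < a j := hmono hij
  have hle : ∀ l < N, a l ≤ a (N - 1) := fun l hl => hmono.monotone (by omega)
  have hNj : N ≤ j := by
    by_contra! hj
    have := hle j hj
    omega
  obtain ⟨j', rfl, hj'⟩ := hshift j hNj (by omega)
  rcases lt_or_ge i N with hi | hi
  · have := hle i hi
    omega
  · obtain ⟨i', rfl, hi'⟩ := hshift i hi (by omega)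
    exact hz2 i' j' (by omega) (by omega)
end

section
/- Let A be a finite 3-free set of nonnegative integers such that the Stanley sequence S(A) is independent with character λ (where λ is an integer). Then λ ≥ 0. -/
/-- Past its generating set, a Stanley sequence at most doubles, up to one: the number `2 * a k + 1`
is too large to be the last term of a progression that starts with two of the first terms. -/
theorem IsStanleySeq.apply_succ_le {A : Finset ℕ} {a : ℕ → ℕ} (ha : IsStanleySeq A a) {k : ℕ}
    (hk : A.card ≤ k + 1) : a (k + 1) ≤ 2 * a k + 1 := by
  obtain ⟨hmono, -, hgreedy⟩ := ha
  obtain ⟨⟨-, hfree⟩, hleast⟩ := hgreedy k hk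
  have hle : ∀ x ∈ a '' Set.Iic k, x ≤ a k := by
    rintro _ ⟨i, hi, rfl⟩
    exact hmono.monotone hi
  refine hleast ⟨by omega, ?_⟩
  rintro x hx y hy z hz hxy hyz
  rcases hx with hx | rfl <;> rcases hy with hy | rfl <;> rcases hz with hz | rfl
  · exact hfree x (.inl hx) y (.inl hy) z (.inl hz) hxy hyz
  all_goals grind

theorem character_nonneg (A : Finset ℕ) (hA : A.Nonempty) (h3 : ThreeFree ↑A)
    (a : ℕ → ℕ) (ha : IsStanleySeq A a) (lam : ℤ)
    (hind : IndependentWithChar a lam) :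
    0 ≤ lam := by
  obtain ⟨κ, hκ⟩ := hind
  obtain ⟨-, hchar⟩ := hκ (max κ A.card) (le_max_left _ _)
  have hcard : A.card < 2 ^ max κ A.card := (le_max_right _ _).trans_lt Nat.lt_two_pow_self
  have hpred : 2 ^ max κ A.card - 1 + 1 = 2 ^ max κ A.card := by omega
  have hle := ha.apply_succ_le (k := 2 ^ max κ A.card - 1) (by omega)
  rw [hpred] at hle
  omega
end
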